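/- arXiv:1409.7537 — 4 statements merged into one kernel-verified Lean document; each statement's English description precedes it below -/
import Mathlib

section
/- For 0 < r < R, the torus of revolution f_{R,r}(u,v) = ((R + r cos u) cos v, (R + r cos u) sin v, r sin u) has Willmore energy W(f_{R,r}) = π² R² / (r √(R² − r²)); moreover π² R² / (r √(R² − r²)) ≥ 2π², with equality if and only if R = √2 · r. -/
open Real MeasureTheory RealInnerProductSpace

noncomputable section

/-- First partial derivative (in the first variable). -/
def pd1 (f : ℝ → ℝ → EuclideanSpace ℝ (Fin 3)) (u v : ℝ) : EuclideanSpace ℝ (Fin 3) :=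
  deriv (fun x => f x v) u

/-- Second partial derivative (in the second variable). -/
def pd2 (f : ℝ → ℝ → EuclideanSpace ℝ (Fin 3)) (u v : ℝ) : EuclideanSpace ℝ (Fin 3) :=
  deriv (fun y => f u y) v

/-- Cross product on Euclidean 3-space. -/
def cross3 (a b : EuclideanSpace ℝ (Fin 3)) : EuclideanSpace ℝ (Fin 3) :=
  (EuclideanSpace.equiv (Fin 3) ℝ).symm
    ![a 1 * b 2 - a 2 * b 1, a 2 * b 0 - a 0 * b 2, a 0 * b 1 - a 1 * b 0]

/-- Coefficients of the first fundamental form. -/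
def coeffE (f : ℝ → ℝ → EuclideanSpace ℝ (Fin 3)) (u v : ℝ) : ℝ := ‖pd1 f u v‖ ^ 2

def coeffF (f : ℝ → ℝ → EuclideanSpace ℝ (Fin 3)) (u v : ℝ) : ℝ := ⟪pd1 f u v, pd2 f u v⟫

def coeffG (f : ℝ → ℝ → EuclideanSpace ℝ (Fin 3)) (u v : ℝ) : ℝ := ‖pd2 f u v‖ ^ 2

/-- The unit normal. -/
def unitNormal (f : ℝ → ℝ → EuclideanSpace ℝ (Fin 3)) (u v : ℝ) : EuclideanSpace ℝ (Fin 3) :=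
  ‖cross3 (pd1 f u v) (pd2 f u v)‖⁻¹ • cross3 (pd1 f u v) (pd2 f u v)

/-- Coefficients of the second fundamental form. -/
def coeffL (f : ℝ → ℝ → EuclideanSpace ℝ (Fin 3)) (u v : ℝ) : ℝ :=
  ⟪pd1 (pd1 f) u v, unitNormal f u v⟫

def coeffM (f : ℝ → ℝ → EuclideanSpace ℝ (Fin 3)) (u v : ℝ) : ℝ :=
  ⟪pd1 (pd2 f) u v, unitNormal f u v⟫

def coeffN (f : ℝ → ℝ → EuclideanSpace ℝ (Fin 3)) (u v : ℝ) : ℝ :=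
  ⟪pd2 (pd2 f) u v, unitNormal f u v⟫

/-- The mean curvature. -/
def meanCurv (f : ℝ → ℝ → EuclideanSpace ℝ (Fin 3)) (u v : ℝ) : ℝ :=
  (coeffE f u v * coeffN f u v - 2 * coeffF f u v * coeffM f u v
      + coeffG f u v * coeffL f u v) /
    (2 * (coeffE f u v * coeffG f u v - coeffF f u v ^ 2))

/-- The Willmore energy of a doubly `2π`-periodic immersion `f : ℝ² → ℝ³`. -/
def willmoreEnergy (f : ℝ → ℝ → EuclideanSpace ℝ (Fin 3)) : ℝ :=
  ∫ u in (0 : ℝ)..(2 * π), ∫ v in (0 : ℝ)..(2 * π),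
    meanCurv f u v ^ 2 *
      Real.sqrt (coeffE f u v * coeffG f u v - coeffF f u v ^ 2)

/-- The torus of revolution with center-circle radius `R` and tube radius `r`. -/
def torusRev (R r : ℝ) (u v : ℝ) : EuclideanSpace ℝ (Fin 3) :=
  (EuclideanSpace.equiv (Fin 3) ℝ).symm
    ![(R + r * Real.cos u) * Real.cos v, (R + r * Real.cos u) * Real.sin v, r * Real.sin u]

lemma hasDerivAt_equiv_symm_vec3 {a b c : ℝ → ℝ} {a' b' c' t : ℝ}
    (ha : HasDerivAt a a' t) (hb : HasDerivAt b b' t) (hc : HasDerivAt c c' t) :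
    HasDerivAt (fun x => (EuclideanSpace.equiv (Fin 3) ℝ).symm ![a x, b x, c x])
      ((EuclideanSpace.equiv (Fin 3) ℝ).symm ![a', b', c']) t := by
  refine (EuclideanSpace.equiv (Fin 3) ℝ).symm.toContinuousLinearMap.hasFDerivAt.comp_hasDerivAt t
    (hasDerivAt_pi.2 fun i => ?_)
  fin_cases i
  exacts [ha, hb, hc]

lemma inner_equiv_symm_vec3 (a b c a' b' c' : ℝ) :
    inner ℝ ((EuclideanSpace.equiv (Fin 3) ℝ).symm ![a, b, c])
      ((EuclideanSpace.equiv (Fin 3) ℝ).symm ![a', b', c']) = a * a' + b * b' + c * c' := by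
  simp [PiLp.inner_apply, Fin.sum_univ_three]
  ring

lemma norm_sq_equiv_symm_vec3 (a b c : ℝ) :
    ‖(EuclideanSpace.equiv (Fin 3) ℝ).symm ![a, b, c]‖ ^ 2 = a ^ 2 + b ^ 2 + c ^ 2 := by
  rw [← real_inner_self_eq_norm_sq, inner_equiv_symm_vec3]
  ring

lemma pd1_torusRev (R r : ℝ) :
    pd1 (torusRev R r) = fun u v => (EuclideanSpace.equiv (Fin 3) ℝ).symm
      ![-(r * sin u) * cos v, -(r * sin u) * sin v, r * cos u] := by
  ext1 u; ext1 v
  have h : HasDerivAt (fun x => R + r * cos x) (-(r * sin u)) u := by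
    simpa using ((hasDerivAt_cos u).const_mul r).const_add R
  exact (hasDerivAt_equiv_symm_vec3 (h.mul_const _) (h.mul_const _)
    ((hasDerivAt_sin u).const_mul r)).deriv

lemma pd2_torusRev (R r : ℝ) :
    pd2 (torusRev R r) = fun u v => (EuclideanSpace.equiv (Fin 3) ℝ).symm
      ![(R + r * cos u) * -sin v, (R + r * cos u) * cos v, 0] := by
  ext1 u; ext1 v
  exact (hasDerivAt_equiv_symm_vec3 ((hasDerivAt_cos v).const_mul _)
    ((hasDerivAt_sin v).const_mul _) (hasDerivAt_const v _)).deriv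

lemma pd1_pd1_torusRev (R r u v : ℝ) :
    pd1 (pd1 (torusRev R r)) u v = (EuclideanSpace.equiv (Fin 3) ℝ).symm
      ![-(r * cos u) * cos v, -(r * cos u) * sin v, r * -sin u] := by
  rw [pd1_torusRev]
  have h : HasDerivAt (fun x => -(r * sin x)) (-(r * cos u)) u :=
    ((hasDerivAt_sin u).const_mul r).neg
  exact (hasDerivAt_equiv_symm_vec3 (h.mul_const _) (h.mul_const _)
    ((hasDerivAt_cos u).const_mul r)).deriv

lemma pd2_pd2_torusRev (R r u v : ℝ) :
    pd2 (pd2 (torusRev R r)) u v = (EuclideanSpace.equiv (Fin 3) ℝ).symm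
      ![(R + r * cos u) * -cos v, (R + r * cos u) * -sin v, 0] := by
  rw [pd2_torusRev]
  exact (hasDerivAt_equiv_symm_vec3 ((hasDerivAt_sin v).neg.const_mul _)
    ((hasDerivAt_cos v).const_mul _) (hasDerivAt_const v _)).deriv

lemma coeffE_torusRev (R r u v : ℝ) : coeffE (torusRev R r) u v = r ^ 2 := by
  rw [coeffE, pd1_torusRev, norm_sq_equiv_symm_vec3]
  linear_combination r ^ 2 * sin u ^ 2 * sin_sq_add_cos_sq v + r ^ 2 * sin_sq_add_cos_sq u

lemma coeffF_torusRev (R r u v : ℝ) : coeffF (torusRev R r) u v = 0 := by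
  rw [coeffF, pd1_torusRev, pd2_torusRev, inner_equiv_symm_vec3]
  ring

lemma coeffG_torusRev (R r u v : ℝ) : coeffG (torusRev R r) u v = (R + r * cos u) ^ 2 := by
  rw [coeffG, pd2_torusRev, norm_sq_equiv_symm_vec3]
  linear_combination (R + r * cos u) ^ 2 * sin_sq_add_cos_sq v

lemma add_mul_cos_pos {R r : ℝ} (hr : 0 < r) (hR : r < R) (u : ℝ) : 0 < R + r * cos u := by
  nlinarith [neg_one_le_cos u]

lemma unitNormal_torusRev {R r : ℝ} (hr : 0 < r) (hR : r < R) (u v : ℝ) :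
    unitNormal (torusRev R r) u v = (EuclideanSpace.equiv (Fin 3) ℝ).symm
      ![-(cos u * cos v), -(cos u * sin v), -sin u] := by
  have hw := add_mul_cos_pos hr hR u
  have hc : cross3 (pd1 (torusRev R r) u v) (pd2 (torusRev R r) u v) =
      (r * (R + r * cos u)) • (EuclideanSpace.equiv (Fin 3) ℝ).symm
        ![-(cos u * cos v), -(cos u * sin v), -sin u] := by
    rw [cross3, pd1_torusRev, pd2_torusRev, ← map_smul]
    congr 1
    ext i
    fin_cases i
    · simp
      ring
    · simp
      ring
    · simp
      linear_combination -(r * sin u * (R + r * cos u)) * sin_sq_add_cos_sq v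
  have hn : ‖(EuclideanSpace.equiv (Fin 3) ℝ).symm
      ![-(cos u * cos v), -(cos u * sin v), -sin u]‖ = 1 := by
    rw [← sq_eq_sq₀ (norm_nonneg _) zero_le_one, norm_sq_equiv_symm_vec3]
    linear_combination cos u ^ 2 * sin_sq_add_cos_sq v + sin_sq_add_cos_sq u
  have hp : 0 < r * (R + r * cos u) := mul_pos hr hw
  rw [unitNormal, hc, norm_smul, hn, mul_one, Real.norm_of_nonneg hp.le, smul_smul,
    inv_mul_cancel₀ hp.ne', one_smul]

lemma coeffL_torusRev {R r : ℝ} (hr : 0 < r) (hR : r < R) (u v : ℝ) :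
    coeffL (torusRev R r) u v = r := by
  rw [coeffL, pd1_pd1_torusRev, unitNormal_torusRev hr hR, inner_equiv_symm_vec3]
  linear_combination r * cos u ^ 2 * sin_sq_add_cos_sq v + r * sin_sq_add_cos_sq u

lemma coeffN_torusRev {R r : ℝ} (hr : 0 < r) (hR : r < R) (u v : ℝ) :
    coeffN (torusRev R r) u v = (R + r * cos u) * cos u := by
  rw [coeffN, pd2_pd2_torusRev, unitNormal_torusRev hr hR, inner_equiv_symm_vec3]
  linear_combination (R + r * cos u) * cos u * sin_sq_add_cos_sq v

lemma meanCurv_torusRev {R r : ℝ} (hr : 0 < r) (hR : r < R) (u v : ℝ) :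
    meanCurv (torusRev R r) u v = (R + 2 * r * cos u) / (2 * r * (R + r * cos u)) := by
  have hw := (add_mul_cos_pos hr hR u).ne'
  rw [meanCurv, coeffE_torusRev, coeffF_torusRev, coeffG_torusRev, coeffL_torusRev hr hR,
    coeffN_torusRev hr hR, div_eq_div_iff (by simp [hr.ne', hw]) (by simp [hr.ne', hw])]
  ring

lemma willmore_integrand_torusRev {R r : ℝ} (hr : 0 < r) (hR : r < R) (u v : ℝ) :
    meanCurv (torusRev R r) u v ^ 2 *
      √(coeffE (torusRev R r) u v * coeffG (torusRev R r) u v - coeffF (torusRev R r) u v ^ 2) =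
      cos u + R ^ 2 / (4 * r) * (R + r * cos u)⁻¹ := by
  have hw := add_mul_cos_pos hr hR u
  have hs : r ^ 2 * (R + r * cos u) ^ 2 - 0 ^ 2 = (r * (R + r * cos u)) ^ 2 := by ring
  rw [meanCurv_torusRev hr hR, coeffE_torusRev, coeffF_torusRev, coeffG_torusRev, hs,
    Real.sqrt_sq (mul_pos hr hw).le]
  field_simp
  ring

lemma integral_inv_add_mul_cos {R r : ℝ} (hr : 0 < r) (hR : r < R) :
    ∫ u in (0 : ℝ)..(2 * π), (R + r * cos u)⁻¹ = 2 * π / √(R ^ 2 - r ^ 2) := by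
  have hd : 0 < R ^ 2 - r ^ 2 := by nlinarith
  set q := √(R ^ 2 - r ^ 2) with hq
  have hq0 : 0 < q := Real.sqrt_pos.2 hd
  have hq2 : q ^ 2 = R ^ 2 - r ^ 2 := Real.sq_sqrt hd.le
  have hderiv (u : ℝ) : HasDerivAt
      (fun x => (x - 2 * arctan (r * sin x / (R + q + r * cos x))) / q)
      (R + r * cos u)⁻¹ u := by
    have hw := add_mul_cos_pos hr hR u
    have hp : 0 < R + q + r * cos u := by linarith
    have h := ((hasDerivAt_id u).sub ((((hasDerivAt_sin u).const_mul r).div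
      (((hasDerivAt_cos u).const_mul r).const_add (R + q)) hp.ne').arctan.const_mul 2)).div_const q
    refine h.congr_deriv ?_
    have hRq : 0 < R + q := by linarith
    have hden : (R + q + r * cos u) ^ 2 + (r * sin u) ^ 2 =
        2 * (R + q) * (R + r * cos u) := by
      linear_combination r ^ 2 * sin_sq_add_cos_sq u + hq2
    have hnum : r * cos u * (R + q + r * cos u) - r * sin u * (r * -sin u) =
        r * cos u * (R + q) + r ^ 2 := by
      linear_combination r ^ 2 * sin_sq_add_cos_sq u
    have hone : 1 + (r * sin u / (R + q + r * cos u)) ^ 2 =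
        2 * (R + q) * (R + r * cos u) / (R + q + r * cos u) ^ 2 := by
      rw [← hden]
      field_simp
    rw [hnum, Pi.div_apply, hone]
    field_simp
    linear_combination -hq2
  have hcont : Continuous fun u => (R + r * cos u)⁻¹ :=
    Continuous.inv₀ (by fun_prop) fun u => (add_mul_cos_pos hr hR u).ne'
  rw [intervalIntegral.integral_eq_sub_of_hasDerivAt (fun u _ => hderiv u)
    (hcont.intervalIntegrable _ _)]
  simp

lemma willmoreEnergy_torusRev {R r : ℝ} (hr : 0 < r) (hR : r < R) :
    willmoreEnergy (torusRev R r) = π ^ 2 * R ^ 2 / (r * √(R ^ 2 - r ^ 2)) := by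
  have hcont : Continuous fun u => (R + r * cos u)⁻¹ :=
    Continuous.inv₀ (by fun_prop) fun u => (add_mul_cos_pos hr hR u).ne'
  have hq0 : 0 < √(R ^ 2 - r ^ 2) := Real.sqrt_pos.2 (by nlinarith)
  simp only [willmoreEnergy, willmore_integrand_torusRev hr hR, intervalIntegral.integral_const,
    smul_eq_mul, intervalIntegral.integral_const_mul]
  rw [intervalIntegral.integral_add (continuous_cos.intervalIntegrable _ _)
    ((hcont.intervalIntegrable _ _).const_mul _), intervalIntegral.integral_const_mul,
    integral_inv_add_mul_cos hr hR, integral_cos, sin_two_pi, sin_zero]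
  field_simp
  ring

/-- Willmore's computation: the torus of revolution with radii `0 < r < R` has Willmore
energy `π² R² / (r √(R² − r²))`; this quantity is at least `2π²`, with equality
iff `R = √2 · r`. -/
theorem willmore_energy_torus_of_revolution (R r : ℝ) (hr : 0 < r) (hR : r < R) :
    willmoreEnergy (torusRev R r) = π ^ 2 * R ^ 2 / (r * Real.sqrt (R ^ 2 - r ^ 2)) ∧
    π ^ 2 * R ^ 2 / (r * Real.sqrt (R ^ 2 - r ^ 2)) ≥ 2 * π ^ 2 ∧
    (π ^ 2 * R ^ 2 / (r * Real.sqrt (R ^ 2 - r ^ 2)) = 2 * π ^ 2 ↔ R = Real.sqrt 2 * r) := by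
  have hd : 0 < R ^ 2 - r ^ 2 := by nlinarith
  refine ⟨willmoreEnergy_torusRev hr hR, ?_⟩
  have hq0 : 0 < √(R ^ 2 - r ^ 2) := Real.sqrt_pos.2 hd
  have hq2 : √(R ^ 2 - r ^ 2) ^ 2 = R ^ 2 - r ^ 2 := Real.sq_sqrt hd.le
  have hdiff : π ^ 2 * R ^ 2 / (r * √(R ^ 2 - r ^ 2)) - 2 * π ^ 2 =
      π ^ 2 * (√(R ^ 2 - r ^ 2) - r) ^ 2 / (r * √(R ^ 2 - r ^ 2)) := by
    field_simp
    linear_combination -hq2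
  refine ⟨sub_nonneg.1 (hdiff ▸ by positivity), ?_⟩
  rw [← sub_eq_zero, hdiff, div_eq_zero_iff, or_iff_left (mul_pos hr hq0).ne', mul_eq_zero,
    or_iff_right (pow_ne_zero 2 pi_ne_zero), sq_eq_zero_iff, sub_eq_zero,
    ← sq_eq_sq₀ hq0.le hr.le, hq2, ← sq_eq_sq₀ (hr.trans hR).le (by positivity : 0 ≤ √2 * r),
    mul_pow, Real.sq_sqrt zero_le_two]
  constructor <;> intro h <;> linarith

end
end

section
/- For the standard Hopf link representative in ℝ³ given by γ₁(s) = (cos s, sin s, 0) and γ₂(t) = (1 + cos t, 0, sin t), the Gauss linking integral lk(γ₁,γ₂) = (1/4π) ∫₀^{2π}∫₀^{2π} det(γ₁′(s), γ₂′(t), γ₁(s) − γ₂(t)) / ‖γ₁(s) − γ₂(t)‖³ ds dt has absolute value 1. -/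
open Real MeasureTheory

noncomputable section

/-- The Möbius cross energy of a pair of `2π`-periodic curves. -/
def mobiusEnergy {E : Type*} [NormedAddCommGroup E] [NormedSpace ℝ E] (γ₁ γ₂ : ℝ → E) : ℝ :=
  ∫ s in (0 : ℝ)..(2 * π), ∫ t in (0 : ℝ)..(2 * π),
    ‖deriv γ₁ s‖ * ‖deriv γ₂ t‖ / ‖γ₁ s - γ₂ t‖ ^ 2

/-- The determinant of three column vectors in `ℝ³`. -/
def det3 (a b c : EuclideanSpace ℝ (Fin 3)) : ℝ :=
  Matrix.det !![a 0, b 0, c 0; a 1, b 1, c 1; a 2, b 2, c 2]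

/-- The Gauss linking integral of a pair of `2π`-periodic curves in `ℝ³`. -/
def gaussLinking (γ₁ γ₂ : ℝ → EuclideanSpace ℝ (Fin 3)) : ℝ :=
  (1 / (4 * π)) * ∫ s in (0 : ℝ)..(2 * π), ∫ t in (0 : ℝ)..(2 * π),
    det3 (deriv γ₁ s) (deriv γ₂ t) (γ₁ s - γ₂ t) / ‖γ₁ s - γ₂ t‖ ^ 3

/-- A Hopf link representative in `ℝ³`: the unit circle in the `xy`-plane. -/
def hopfR₁ (s : ℝ) : EuclideanSpace ℝ (Fin 3) :=
  (EuclideanSpace.equiv (Fin 3) ℝ).symm ![Real.cos s, Real.sin s, 0]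

/-- A Hopf link representative in `ℝ³`: a unit circle in the `xz`-plane through the origin
and `(2,0,0)`. -/
def hopfR₂ (t : ℝ) : EuclideanSpace ℝ (Fin 3) :=
  (EuclideanSpace.equiv (Fin 3) ℝ).symm ![1 + Real.cos t, 0, Real.sin t]


namespace HopfLink

/-- The squared distance between the points of the two circles at parameters `s` and `t`. -/
def distSq (s t : ℝ) : ℝ := 1 + 2 * (1 - cos s) * (1 + cos t)

lemma distSq_pos (s t : ℝ) : 0 < distSq s t := by
  have := mul_nonneg (sub_nonneg.2 (cos_le_one s)) (by linarith [neg_one_le_cos t] : 0 ≤ 1 + cos t)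
  unfold distSq
  nlinarith

lemma sqrt_distSq_pos (s t : ℝ) : 0 < √(distSq s t) := sqrt_pos.2 (distSq_pos s t)

/-- The Gauss linking integrand of the two circles. -/
def integrand (s t : ℝ) : ℝ := (cos t - cos s * cos t - cos s) / √(distSq s t) ^ 3

lemma norm_hopfR_sub (s t : ℝ) : ‖hopfR₁ s - hopfR₂ t‖ = √(distSq s t) := by
  rw [EuclideanSpace.norm_eq]
  congr 1
  simp [Fin.sum_univ_three, hopfR₁, hopfR₂, distSq]
  nlinarith [sin_sq_add_cos_sq s, sin_sq_add_cos_sq t]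

lemma deriv_hopfR₁ (s : ℝ) :
    deriv hopfR₁ s = (EuclideanSpace.equiv (Fin 3) ℝ).symm ![-sin s, cos s, 0] := by
  refine HasDerivAt.deriv ?_
  refine (EuclideanSpace.equiv (Fin 3) ℝ).symm.hasFDerivAt.comp_hasDerivAt s (hasDerivAt_pi.2 ?_)
  intro i
  fin_cases i
  · exact hasDerivAt_cos s
  · exact hasDerivAt_sin s
  · exact hasDerivAt_const s 0

lemma deriv_hopfR₂ (t : ℝ) :
    deriv hopfR₂ t = (EuclideanSpace.equiv (Fin 3) ℝ).symm ![-sin t, 0, cos t] := by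
  refine HasDerivAt.deriv ?_
  refine (EuclideanSpace.equiv (Fin 3) ℝ).symm.hasFDerivAt.comp_hasDerivAt t (hasDerivAt_pi.2 ?_)
  intro i
  fin_cases i
  · exact (hasDerivAt_cos t).const_add 1
  · exact hasDerivAt_const t 0
  · exact hasDerivAt_sin t

lemma det3_div_norm_eq_integrand (s t : ℝ) :
    det3 (deriv hopfR₁ s) (deriv hopfR₂ t) (hopfR₁ s - hopfR₂ t) / ‖hopfR₁ s - hopfR₂ t‖ ^ 3 =
      integrand s t := by
  rw [norm_hopfR_sub, deriv_hopfR₁, deriv_hopfR₂, integrand]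
  congr 1
  simp [det3, Matrix.det_fin_three, hopfR₁, hopfR₂]
  linear_combination cos t * sin_sq_add_cos_sq s - cos s * sin_sq_add_cos_sq t

lemma continuous_integrand : Continuous (Function.uncurry integrand) := by
  unfold Function.uncurry integrand
  refine Continuous.div (by fun_prop) (by unfold distSq; fun_prop) fun p ↦ ?_
  exact (pow_pos (sqrt_distSq_pos _ _) 3).ne'

lemma integral_zero_two_pi_eq_two_mul {g : ℝ → ℝ} (hg : Continuous g)
    (hsymm : ∀ x, g (2 * π - x) = g x) :
    ∫ x in (0 : ℝ)..(2 * π), g x = 2 * ∫ x in (0 : ℝ)..π, g x := by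
  have hrefl : ∫ x in π..(2 * π), g x = ∫ x in (0 : ℝ)..π, g x := by
    have := intervalIntegral.integral_comp_sub_left (a := 0) (b := π) g (2 * π)
    simp only [hsymm] at this
    rw [this]
    congr 1 <;> ring
  rw [← intervalIntegral.integral_add_adjacent_intervals (hg.intervalIntegrable 0 π)
    (hg.intervalIntegrable π (2 * π)), hrefl, two_mul]

/-- The azimuth, around the first coordinate axis, of the difference of the two points. -/
def azimuth (s t : ℝ) : ℝ := Complex.arg (⟨sin s, sin t⟩ : ℂ)

/-- The cosine of the angle between the first coordinate axis and the difference of the two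
points. -/
def height (s t : ℝ) : ℝ := (cos s - 1 - cos t) / √(distSq s t)

/-- The partial derivative of `height` in its first variable, without the factor `sin s`. -/
def heightFst (s t : ℝ) : ℝ := -(1 + (1 + cos t) * (1 - cos s - cos t)) / √(distSq s t) ^ 3

/-- The partial derivative of `height` in its second variable, without the factor `sin t`. -/
def heightSnd (s t : ℝ) : ℝ := (1 + (1 - cos s) * (1 + cos s + cos t)) / √(distSq s t) ^ 3

lemma hasDerivAt_sqrt_distSq_fst (s t : ℝ) :
    HasDerivAt (fun s ↦ √(distSq s t)) (sin s * (1 + cos t) / √(distSq s t)) s := by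
  have h : HasDerivAt (fun s ↦ distSq s t) (2 * sin s * (1 + cos t)) s := by
    unfold distSq
    convert! ((((hasDerivAt_cos s).const_sub 1).const_mul 2).mul_const (1 + cos t)).const_add 1
      using 1
    ring
  convert! h.sqrt (distSq_pos s t).ne' using 1
  field_simp

lemma hasDerivAt_sqrt_distSq_snd (s t : ℝ) :
    HasDerivAt (fun t ↦ √(distSq s t)) (-(sin t * (1 - cos s)) / √(distSq s t)) t := by
  have h : HasDerivAt (fun t ↦ distSq s t) (-(2 * sin t * (1 - cos s))) t := by
    unfold distSq
    convert! (((hasDerivAt_cos t).const_add 1).const_mul (2 * (1 - cos s))).const_add 1 using 1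
    ring
  convert! h.sqrt (distSq_pos s t).ne' using 1
  field_simp

lemma hasDerivAt_height_snd (s t : ℝ) :
    HasDerivAt (fun t ↦ height s t) (sin t * heightSnd s t) t := by
  have hr := sqrt_distSq_pos s t
  have hsq : √(distSq s t) ^ 2 = 1 + 2 * (1 - cos s) * (1 + cos t) := sq_sqrt (distSq_pos s t).le
  convert! ((hasDerivAt_cos t).const_sub (cos s - 1)).div (hasDerivAt_sqrt_distSq_snd s t) hr.ne'
    using 1
  unfold heightSnd
  field_simp
  rw [hsq]
  ring

lemma hasDerivAt_heightFst (s t : ℝ) :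
    HasDerivAt (fun t ↦ heightFst s t)
      (sin t * ((1 - cos s - cos t) - (1 + cos t)) / √(distSq s t) ^ 3 -
        3 * (1 + (1 + cos t) * (1 - cos s - cos t)) * (sin t * (1 - cos s)) / √(distSq s t) ^ 5)
      t := by
  have hr := sqrt_distSq_pos s t
  convert! ((((hasDerivAt_cos t).const_add 1).mul
    ((hasDerivAt_cos t).const_sub (1 - cos s))).const_add 1).neg.div
    ((hasDerivAt_sqrt_distSq_snd s t).pow 3) (pow_pos hr 3).ne' using 1
  field_simp
  simp
  ring

lemma hasDerivAt_heightSnd (s t : ℝ) :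
    HasDerivAt (fun s ↦ heightSnd s t)
      (sin s * ((1 + cos s + cos t) - (1 - cos s)) / √(distSq s t) ^ 3 -
        3 * (1 + (1 - cos s) * (1 + cos s + cos t)) * (sin s * (1 + cos t)) / √(distSq s t) ^ 5)
      s := by
  have hr := sqrt_distSq_pos s t
  convert! ((((hasDerivAt_cos s).const_sub 1).mul
    (((hasDerivAt_cos s).const_add 1).add_const (cos t))).const_add 1).div
    ((hasDerivAt_sqrt_distSq_fst s t).pow 3) (pow_pos hr 3).ne' using 1
  field_simp
  simp
  ring

lemma hasDerivAt_height_mixed (s t : ℝ) : ∃ m,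
    HasDerivAt (fun t ↦ heightFst s t) (sin t * m) t ∧
      HasDerivAt (fun s ↦ heightSnd s t) (sin s * m) s := by
  have hr := sqrt_distSq_pos s t
  have hsq : √(distSq s t) ^ 2 = 1 + 2 * (1 - cos s) * (1 + cos t) := sq_sqrt (distSq_pos s t).le
  refine ⟨_, (hasDerivAt_heightFst s t).congr_deriv ?_, (hasDerivAt_heightSnd s t).congr_deriv
    (g' := sin s * (((1 + cos s + cos t) - (1 - cos s)) / √(distSq s t) ^ 3 -
        3 * (1 + (1 - cos s) * (1 + cos s + cos t)) * (1 + cos t) / √(distSq s t) ^ 5)) (by ring)⟩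
  field_simp
  rw [hsq]
  ring

lemma hasDerivAt_azimuth_fst {s : ℝ} (t : ℝ) (hs : 0 < sin s) :
    HasDerivAt (fun s ↦ azimuth s t) (-(cos s * sin t) / (sin s ^ 2 + sin t ^ 2)) s := by
  have hz : HasDerivAt (fun s ↦ (⟨sin s, sin t⟩ : ℂ)) ⟨cos s, 0⟩ s := by
    have := Complex.equivRealProdCLM.symm.hasFDerivAt.comp_hasDerivAt s
      ((hasDerivAt_sin s).prodMk (hasDerivAt_const s (sin t)))
    exact this
  simp only [azimuth, ← Complex.log_im]
  refine (Complex.imCLM.hasFDerivAt.comp_hasDerivAt s (hz.clog_real (Or.inl hs))).congr_deriv ?_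
  simp [Complex.div_im, Complex.normSq_apply]
  ring

lemma hasDerivAt_azimuth_snd {s : ℝ} (t : ℝ) (hs : 0 < sin s) :
    HasDerivAt (fun t ↦ azimuth s t) (cos t * sin s / (sin s ^ 2 + sin t ^ 2)) t := by
  have hz : HasDerivAt (fun t ↦ (⟨sin s, sin t⟩ : ℂ)) ⟨0, cos t⟩ t := by
    have := Complex.equivRealProdCLM.symm.hasFDerivAt.comp_hasDerivAt t
      ((hasDerivAt_const t (sin s)).prodMk (hasDerivAt_sin t))
    exact this
  simp only [azimuth, ← Complex.log_im]
  refine (Complex.imCLM.hasFDerivAt.comp_hasDerivAt t (hz.clog_real (Or.inl hs))).congr_deriv ?_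
  simp [Complex.div_im, Complex.normSq_apply]
  ring

lemma differentiableAt_azimuth {p : ℝ × ℝ} (hs : 0 < sin p.1) :
    DifferentiableAt ℝ (fun p : ℝ × ℝ ↦ azimuth p.1 p.2) p := by
  have hz : DifferentiableAt ℝ (fun p : ℝ × ℝ ↦ (⟨sin p.1, sin p.2⟩ : ℂ)) p := by
    have : DifferentiableAt ℝ (fun p : ℝ × ℝ ↦ (sin p.1, sin p.2)) p := by fun_prop
    exact Complex.equivRealProdCLM.symm.differentiableAt.comp p this
  have hlog : DifferentiableAt ℝ Complex.log ⟨sin p.1, sin p.2⟩ :=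
    (Complex.hasStrictFDerivAt_log_real (x := ⟨sin p.1, sin p.2⟩) (Or.inl hs)).differentiableAt
  simp only [azimuth, ← Complex.log_im]
  exact Complex.imCLM.differentiableAt.comp p (hlog.comp p hz)

lemma differentiable_sqrt_distSq : Differentiable ℝ (fun p : ℝ × ℝ ↦ √(distSq p.1 p.2)) := by
  have h : Differentiable ℝ (fun p : ℝ × ℝ ↦ distSq p.1 p.2) := by unfold distSq; fun_prop
  exact h.sqrt fun p ↦ (distSq_pos p.1 p.2).ne'

lemma differentiable_heightFst : Differentiable ℝ (fun p : ℝ × ℝ ↦ heightFst p.1 p.2) := by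
  unfold heightFst
  simp only [div_eq_mul_inv]
  exact Differentiable.fun_mul (by fun_prop) ((differentiable_sqrt_distSq.fun_pow 3).fun_inv
    fun p ↦ (pow_pos (sqrt_distSq_pos p.1 p.2) 3).ne')

lemma differentiable_heightSnd : Differentiable ℝ (fun p : ℝ × ℝ ↦ heightSnd p.1 p.2) := by
  unfold heightSnd
  simp only [div_eq_mul_inv]
  exact Differentiable.fun_mul (by fun_prop) ((differentiable_sqrt_distSq.fun_pow 3).fun_inv
    fun p ↦ (pow_pos (sqrt_distSq_pos p.1 p.2) 3).ne')

lemma continuousOn_arg_mul {w : ℂ → ℝ} (hw : Continuous w) (hw0 : w 0 = 0) :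
    ContinuousOn (fun z ↦ z.arg * w z) {z | 0 ≤ z.re ∧ 0 ≤ z.im} := by
  rintro z ⟨hre, him⟩
  refine ContinuousAt.continuousWithinAt ?_
  rcases eq_or_ne z 0 with rfl | hz
  · rw [ContinuousAt, hw0, mul_zero]
    exact bdd_le_mul_tendsto_zero' π (.of_forall Complex.abs_arg_le_pi) (hw0 ▸ hw.tendsto 0)
  · have hmem : z ∈ Complex.slitPlane := by
      rw [Complex.mem_slitPlane_iff]
      by_contra! h
      exact hz (Complex.ext (le_antisymm h.1 hre) h.2)
    exact (Complex.continuousAt_arg hmem).mul hw.continuousAt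

lemma continuousOn_azimuth_mul {w : ℂ → ℝ} (hw : Continuous w) (hw0 : w 0 = 0) :
    ContinuousOn (fun p : ℝ × ℝ ↦ azimuth p.1 p.2 * w ⟨sin p.1, sin p.2⟩)
      (Set.Icc 0 π ×ˢ Set.Icc 0 π) := by
  have hz : Continuous (fun p : ℝ × ℝ ↦ (⟨sin p.1, sin p.2⟩ : ℂ)) := by
    have : Continuous (fun p : ℝ × ℝ ↦ (sin p.1, sin p.2)) := by fun_prop
    exact Complex.equivRealProdCLM.symm.continuous.comp this
  exact (continuousOn_arg_mul hw hw0).comp hz.continuousOn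
    fun p hp ↦ ⟨sin_nonneg_of_mem_Icc hp.1, sin_nonneg_of_mem_Icc hp.2⟩

/-- First component of a vector field whose divergence is the linking integrand. -/
def fieldFst (p : ℝ × ℝ) : ℝ := azimuth p.1 p.2 * sin p.2 * heightSnd p.1 p.2

/-- Second component of a vector field whose divergence is the linking integrand. -/
def fieldSnd (p : ℝ × ℝ) : ℝ := -(azimuth p.1 p.2 * sin p.1 * heightFst p.1 p.2)

lemma continuousOn_fieldFst : ContinuousOn fieldFst (Set.Icc 0 π ×ˢ Set.Icc 0 π) :=
  (continuousOn_azimuth_mul Complex.continuous_im rfl).mul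
    differentiable_heightSnd.continuous.continuousOn

lemma continuousOn_fieldSnd : ContinuousOn fieldSnd (Set.Icc 0 π ×ˢ Set.Icc 0 π) :=
  ((continuousOn_azimuth_mul Complex.continuous_re rfl).mul
    differentiable_heightFst.continuous.continuousOn).neg

lemma exists_hasFDerivAt_field {p : ℝ × ℝ} (hs : 0 < sin p.1) :
    ∃ f' g' : ℝ × ℝ →L[ℝ] ℝ, HasFDerivAt fieldFst f' p ∧ HasFDerivAt fieldSnd g' p ∧
      f' (1, 0) + g' (0, 1) = integrand p.1 p.2 := by
  obtain ⟨s, t⟩ := p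
  replace hs : 0 < sin s := hs
  have hF : DifferentiableAt ℝ fieldFst (s, t) :=
    ((differentiableAt_azimuth (p := (s, t)) hs).fun_mul
      (Differentiable.differentiableAt (by fun_prop))).fun_mul (differentiable_heightSnd (s, t))
  have hG : DifferentiableAt ℝ fieldSnd (s, t) :=
    (((differentiableAt_azimuth (p := (s, t)) hs).fun_mul
      (Differentiable.differentiableAt (by fun_prop))).fun_mul
        (differentiable_heightFst (s, t))).fun_neg
  refine ⟨_, _, hF.hasFDerivAt, hG.hasFDerivAt, ?_⟩
  obtain ⟨m, hm₁, hm₂⟩ := hasDerivAt_height_mixed s t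
  have hF' : HasDerivAt (fun s ↦ fieldFst (s, t)) (fderiv ℝ fieldFst (s, t) (1, 0)) s :=
    HasFDerivAt.comp_hasDerivAt (f := fun s ↦ (s, t)) s hF.hasFDerivAt
      ((hasDerivAt_id' s).prodMk (hasDerivAt_const s t))
  have hG' : HasDerivAt (fun t ↦ fieldSnd (s, t)) (fderiv ℝ fieldSnd (s, t) (0, 1)) t :=
    HasFDerivAt.comp_hasDerivAt (f := fun t ↦ (s, t)) t hG.hasFDerivAt
      ((hasDerivAt_const t s).prodMk (hasDerivAt_id' t))
  have hFst : HasDerivAt (fun s ↦ fieldFst (s, t)) _ s :=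
    ((hasDerivAt_azimuth_fst t hs).fun_mul (hasDerivAt_const s (sin t))).fun_mul hm₂
  have hSnd : HasDerivAt (fun t ↦ fieldSnd (s, t)) _ t :=
    (((hasDerivAt_azimuth_snd t hs).fun_mul
    (hasDerivAt_const t (sin s))).fun_mul hm₁).fun_neg
  rw [hF'.unique hFst, hG'.unique hSnd,
    integrand, heightFst, heightSnd]
  have hr := sqrt_distSq_pos s t
  have hS : 0 < sin s ^ 2 + sin t ^ 2 := by
    positivity
  field_simp
  rw [sin_sq s, sin_sq t]
  ring

lemma integral_quarter : ∫ s in (0 : ℝ)..π, ∫ t in (0 : ℝ)..π, integrand s t = -π := by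
  have key : ∀ p : ℝ × ℝ, ∃ f' g' : ℝ × ℝ →L[ℝ] ℝ,
      (p ∈ Set.Ioo 0 π ×ˢ Set.Ioo 0 π → HasFDerivAt fieldFst f' p ∧ HasFDerivAt fieldSnd g' p) ∧
        f' (1, 0) + g' (0, 1) = integrand p.1 p.2 := by
    intro p
    by_cases hp : p ∈ Set.Ioo 0 π ×ˢ Set.Ioo 0 π
    · obtain ⟨f', g', hf, hg, h⟩ := exists_hasFDerivAt_field (sin_pos_of_mem_Ioo hp.1)
      exact ⟨f', g', fun _ ↦ ⟨hf, hg⟩, h⟩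
    · exact ⟨integrand p.1 p.2 • ContinuousLinearMap.fst ℝ ℝ ℝ, 0, fun h ↦ (hp h).elim, by simp⟩
  choose f' g' hfg hdiv using key
  have hπ := pi_pos.le
  have h := integral2_divergence_prod_of_hasFDerivAt_off_countable fieldFst fieldSnd f' g' 0 0 π π ∅
    Set.countable_empty (by simpa [Set.uIcc_of_le hπ] using continuousOn_fieldFst)
    (by simpa [Set.uIcc_of_le hπ] using continuousOn_fieldSnd)
    (fun p hp ↦ (hfg p (by simpa [hπ] using hp)).1) (fun p hp ↦ (hfg p (by simpa [hπ] using hp)).2)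
    (by
      simp only [hdiv]
      exact continuous_integrand.continuousOn.integrableOn_compact
        (isCompact_uIcc.prod isCompact_uIcc))
  simp only [hdiv] at h
  rw [h]
  have hzero : ∀ c, sin c = 0 → ∫ s in (0 : ℝ)..π, fieldSnd (s, c) = 0 := by
    intro c hc
    refine (intervalIntegral.integral_congr fun s hs ↦ ?_).trans intervalIntegral.integral_zero
    rw [Set.uIcc_of_le hπ] at hs
    have : azimuth s c = 0 := Complex.arg_eq_zero_iff.2 ⟨sin_nonneg_of_mem_Icc hs, hc⟩
    simp [fieldSnd, this]
  have hside : ∀ c, sin c = 0 →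
      ∫ t in (0 : ℝ)..π, fieldFst (c, t) = π / 2 * (height c π - height c 0) := by
    intro c hc
    have hcont : Continuous fun t ↦ sin t * heightSnd c t :=
      continuous_sin.mul (differentiable_heightSnd.continuous.uncurry_left (f := heightSnd) c)
    rw [← intervalIntegral.integral_eq_sub_of_hasDerivAt
      (fun t _ ↦ hasDerivAt_height_snd c t) (hcont.intervalIntegrable _ _),
      ← intervalIntegral.integral_const_mul]
    refine intervalIntegral.integral_congr fun t ht ↦ ?_
    rw [Set.uIcc_of_le hπ] at ht
    simp only [fieldFst, mul_assoc]
    rcases (sin_nonneg_of_mem_Icc ht).eq_or_lt with h0 | hpos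
    · simp [← h0]
    · rw [show azimuth c t = π / 2 from Complex.arg_eq_pi_div_two_iff.2 ⟨hc, hpos⟩]
  rw [hzero _ sin_pi, hzero _ sin_zero, hside _ sin_pi, hside _ sin_zero]
  have h9 : √(9 : ℝ) = 3 := by rw [show (9 : ℝ) = 3 ^ 2 by norm_num]; simp
  norm_num [height, distSq, h9]

lemma integral_integrand :
    ∫ s in (0 : ℝ)..(2 * π), ∫ t in (0 : ℝ)..(2 * π), integrand s t = -(4 * π) := by
  have hinner : ∀ s, ∫ t in (0 : ℝ)..(2 * π), integrand s t =
      2 * ∫ t in (0 : ℝ)..π, integrand s t := fun s ↦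
    integral_zero_two_pi_eq_two_mul (continuous_integrand.uncurry_left s)
      fun t ↦ by simp [integrand, distSq, cos_two_pi_sub]
  simp only [hinner, intervalIntegral.integral_const_mul]
  rw [integral_zero_two_pi_eq_two_mul
    (intervalIntegral.continuous_parametric_intervalIntegral_of_continuous'
      continuous_integrand 0 π)
    fun s ↦ by simp [integrand, distSq, cos_two_pi_sub], integral_quarter]
  ring

end HopfLink

/-- The standard Hopf link representative in `ℝ³` has Gauss linking integral of
absolute value `1`. -/
theorem gaussLinking_hopfLink : |gaussLinking hopfR₁ hopfR₂| = 1 := by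
  simp only [gaussLinking, HopfLink.det3_div_norm_eq_integrand, HopfLink.integral_integrand]
  rw [mul_neg, abs_neg, one_div_mul_cancel (by positivity), abs_one]

end
end

section
/- For every 2-component link in ℝ³, the Möbius cross energy is bounded below by 4π times the absolute value of the linking number: for C¹ maps γ₁, γ₂ : ℝ → ℝ³, 2π-periodic, with disjoint images, E(γ₁,γ₂) ≥ 4π · |lk(γ₁,γ₂)|. -/
open Real MeasureTheory

noncomputable section

/-- Hadamard's inequality in dimension three. -/
theorem abs_det3_le (a b c : EuclideanSpace ℝ (Fin 3)) :
    |det3 a b c| ≤ ‖a‖ * ‖b‖ * ‖c‖ := by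
  refine abs_le_of_sq_le_sq ?_ (by positivity)
  have hdet : det3 a b c = (a 1 * b 2 - a 2 * b 1) * c 0 + (a 2 * b 0 - a 0 * b 2) * c 1
      + (a 0 * b 1 - a 1 * b 0) * c 2 := by
    simp [det3, Matrix.det_fin_three]
    ring
  rw [hdet, mul_pow, mul_pow, EuclideanSpace.real_norm_sq_eq, EuclideanSpace.real_norm_sq_eq,
    EuclideanSpace.real_norm_sq_eq, Fin.sum_univ_three, Fin.sum_univ_three, Fin.sum_univ_three]
  generalize hx : a 1 * b 2 - a 2 * b 1 = x
  generalize hy : a 2 * b 0 - a 0 * b 2 = y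
  generalize hz : a 0 * b 1 - a 1 * b 0 = z
  have hcross : x ^ 2 + y ^ 2 + z ^ 2 ≤
      (a 0 ^ 2 + a 1 ^ 2 + a 2 ^ 2) * (b 0 ^ 2 + b 1 ^ 2 + b 2 ^ 2) := by
    subst hx hy hz
    nlinarith [sq_nonneg (a 0 * b 0 + a 1 * b 1 + a 2 * b 2)]
  calc (x * c 0 + y * c 1 + z * c 2) ^ 2
      ≤ (x ^ 2 + y ^ 2 + z ^ 2) * (c 0 ^ 2 + c 1 ^ 2 + c 2 ^ 2) := by
        nlinarith [sq_nonneg (x * c 1 - y * c 0), sq_nonneg (x * c 2 - z * c 0),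
          sq_nonneg (y * c 2 - z * c 1)]
    _ ≤ _ := mul_le_mul_of_nonneg_right hcross (by positivity)

/-- The Gauss integrand is bounded by the Möbius energy density. -/
theorem abs_det3_div_norm_pow_three_le (a b c : EuclideanSpace ℝ (Fin 3)) (hc : c ≠ 0) :
    |det3 a b c / ‖c‖ ^ 3| ≤ ‖a‖ * ‖b‖ / ‖c‖ ^ 2 := by
  have hc' : 0 < ‖c‖ := norm_pos_iff.mpr hc
  rw [abs_div, abs_of_pos (pow_pos hc' 3), div_le_div_iff₀ (by positivity) (by positivity)]
  calc |det3 a b c| * ‖c‖ ^ 2 ≤ ‖a‖ * ‖b‖ * ‖c‖ * ‖c‖ ^ 2 :=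
        mul_le_mul_of_nonneg_right (abs_det3_le a b c) (by positivity)
    _ = ‖a‖ * ‖b‖ * ‖c‖ ^ 3 := by ring

/-- A pointwise bound between functions with a continuous majorant passes to iterated integrals. -/
theorem abs_intervalIntegral_intervalIntegral_le {f g : ℝ → ℝ → ℝ} {a b c d : ℝ}
    (hab : a ≤ b) (hcd : c ≤ d) (hg : Continuous (Function.uncurry g))
    (hfg : ∀ s t, |f s t| ≤ g s t) :
    |∫ s in a..b, ∫ t in c..d, f s t| ≤ ∫ s in a..b, ∫ t in c..d, g s t := by
  have hinner (s : ℝ) : ‖∫ t in c..d, f s t‖ ≤ ∫ t in c..d, g s t :=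
    intervalIntegral.norm_integral_le_of_norm_le hcd (.of_forall fun t _ => hfg s t)
      ((hg.comp (Continuous.prodMk_right s)).intervalIntegrable c d)
  exact intervalIntegral.norm_integral_le_of_norm_le hab (.of_forall fun s _ => hinner s)
    ((intervalIntegral.continuous_parametric_intervalIntegral_of_continuous' hg c d).intervalIntegrable
      a b)

/-- The Möbius cross energy of a `2`-component link in `ℝ³` is bounded below by `4π` times
the absolute value of its linking number. -/
theorem mobiusEnergy_ge_linking (γ₁ γ₂ : ℝ → EuclideanSpace ℝ (Fin 3))
    (h₁ : ContDiff ℝ 1 γ₁) (h₂ : ContDiff ℝ 1 γ₂)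
    (hper₁ : Function.Periodic γ₁ (2 * π)) (hper₂ : Function.Periodic γ₂ (2 * π))
    (hdisj : ∀ s t, γ₁ s ≠ γ₂ t) :
    mobiusEnergy γ₁ γ₂ ≥ 4 * π * |gaussLinking γ₁ γ₂| := by
  have hpi : (0 : ℝ) ≤ 2 * π := by positivity
  have hd₁ : Continuous (deriv γ₁) := h₁.continuous_deriv le_rfl
  have hd₂ : Continuous (deriv γ₂) := h₂.continuous_deriv le_rfl
  have hg : Continuous (Function.uncurry fun s t : ℝ =>
      ‖deriv γ₁ s‖ * ‖deriv γ₂ t‖ / ‖γ₁ s - γ₂ t‖ ^ 2) := by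
    have hc₁ := h₁.continuous
    have hc₂ := h₂.continuous
    refine Continuous.div (by fun_prop) (by fun_prop) fun p => ?_
    exact pow_ne_zero 2 (norm_ne_zero_iff.mpr (sub_ne_zero.mpr (hdisj p.1 p.2)))
  have hbound := abs_intervalIntegral_intervalIntegral_le hpi hpi hg fun s t =>
    abs_det3_div_norm_pow_three_le (deriv γ₁ s) (deriv γ₂ t) (γ₁ s - γ₂ t)
      (sub_ne_zero.mpr (hdisj s t))
  rw [ge_iff_le, gaussLinking, abs_mul, abs_of_pos (by positivity : 0 < 1 / (4 * π)), ← mul_assoc,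
    mul_one_div_cancel (by positivity), one_mul]
  exact hbound

end
end

section
/- (Agol–Marques–Neves, Freedman–He–Wang conjecture) Every 2-component link in ℝ³ with linking number ±1 has Möbius cross energy at least 2π². Precisely: for C¹ maps γ₁, γ₂ : ℝ → ℝ³, 2π-periodic, with disjoint images, if |lk(γ₁,γ₂)| = 1 then E(γ₁,γ₂) ≥ 2π². -/
open Real MeasureTheory

noncomputable section

open Set Filter Topology

section ParametricIntegral

variable {X F : Type*} [NormedAddCommGroup F] [NormedSpace ℝ F]

theorem continuousOn_intervalIntegral_of_continuousOn_prod [TopologicalSpace X] {U : Set X}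
    {f : X → ℝ → F} (hf : ContinuousOn (Function.uncurry f) (U ×ˢ univ)) (a b : ℝ) :
    ContinuousOn (fun x => ∫ t in a..b, f x t) U := by
  rw [continuousOn_iff_continuous_domRestrict]
  have h : Continuous (Function.uncurry fun (x : U) (t : ℝ) => f x t) :=
    hf.comp_continuous (f := fun p : U × ℝ => ((p.1 : X), p.2)) (by fun_prop)
      (fun p => ⟨p.1.2, mem_univ _⟩)
  exact intervalIntegral.continuous_parametric_intervalIntegral_of_continuous' h a b

theorem continuous_section_of_continuousOn_prod [TopologicalSpace X] {U : Set X} {G : Type*}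
    [TopologicalSpace G] {f : X → ℝ → G}
    (hf : ContinuousOn (Function.uncurry f) (U ×ˢ univ)) {x : X} (hx : x ∈ U) :
    Continuous (f x) :=
  hf.comp_continuous (f := fun t : ℝ => (x, t)) (by fun_prop) (fun _ => ⟨hx, mem_univ _⟩)

theorem hasFDerivAt_intervalIntegral_of_continuousOn_prod [NormedAddCommGroup X] [NormedSpace ℝ X]
    {U : Set X} (hU : IsOpen U) {f : X → ℝ → F} {f' : X → ℝ → X →L[ℝ] F}
    (hf : ContinuousOn (Function.uncurry f) (U ×ˢ univ))
    (hf' : ContinuousOn (Function.uncurry f') (U ×ˢ univ))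
    (hd : ∀ x ∈ U, ∀ t, HasFDerivAt (fun y => f y t) (f' x t) x) (a b : ℝ) {x : X} (hx : x ∈ U) :
    HasFDerivAt (fun y => ∫ t in a..b, f y t) (∫ t in a..b, f' x t) x := by
  obtain ⟨C, hC⟩ : ∃ C, ∀ t ∈ uIcc a b, ‖f' x t‖ < C := by
    obtain ⟨C, hC⟩ := isCompact_uIcc.exists_bound_of_continuousOn
      (continuous_section_of_continuousOn_prod hf' hx).continuousOn (s := uIcc a b)
    exact ⟨C + 1, fun t ht => (hC t ht).trans_lt (lt_add_one C)⟩
  have hopen : IsOpen ((U ×ˢ (univ : Set ℝ)) ∩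
      (fun p => ‖Function.uncurry f' p‖) ⁻¹' Iio C) :=
    hf'.norm.isOpen_inter_preimage (hU.prod isOpen_univ) isOpen_Iio
  obtain ⟨u, v, hu, -, hxu, hv, huv⟩ := generalized_tube_lemma (isCompact_singleton (x := x))
    (isCompact_uIcc (a := a) (b := b)) hopen (by
      rintro ⟨y, t⟩ ⟨rfl, ht⟩
      exact ⟨⟨hx, mem_univ _⟩, hC t ht⟩)
  have hun : u ∈ 𝓝 x := hu.mem_nhds (hxu rfl)
  have hm : ∀ y t, y ∈ u → t ∈ uIoc a b → y ∈ U ∧ ‖f' y t‖ ≤ C := fun y t hy ht => by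
    have := huv (mk_mem_prod hy (hv (uIoc_subset_uIcc ht)))
    exact ⟨this.1.1, le_of_lt this.2⟩
  refine intervalIntegral.hasFDerivAt_integral_of_dominated_of_fderiv_le (bound := fun _ => C)
    (hun) ?_ ?_ ?_ ?_ ?_ ?_
  · filter_upwards [hU.mem_nhds hx] with y hy
    exact (continuous_section_of_continuousOn_prod hf hy).aestronglyMeasurable
  · exact (continuous_section_of_continuousOn_prod hf hx).intervalIntegrable _ _
  · exact (continuous_section_of_continuousOn_prod hf' hx).aestronglyMeasurable
  · exact Eventually.of_forall fun t ht y hy => (hm y t hy ht).2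
  · exact intervalIntegrable_const
  · exact Eventually.of_forall fun t ht y hy => hd y (hm y t hy ht).1 t

end ParametricIntegral

section Monodromy

variable {Y : Type*} [NormedAddCommGroup Y] [NormedSpace ℝ Y]

/-- A family of linear forms is locally exact on a set if it has a primitive near each point. -/
def LocallyExactOn (α : Y → Y →L[ℝ] ℝ) (S : Set Y) : Prop :=
  ∀ x ∈ S, ∃ ε > 0, ∃ F : Y → ℝ, ∀ y ∈ Metric.ball x ε, HasFDerivAt F (α y) y

theorem LocallyExactOn.exists_uniform {α : Y → Y →L[ℝ] ℝ} {K : Set Y} (hα : LocallyExactOn α K)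
    (hK : IsCompact K) :
    ∃ δ > 0, ∃ F : Y → Y → ℝ, ∀ x ∈ K, ∀ y ∈ Metric.ball x δ, HasFDerivAt (F x) (α y) y := by
  choose! ε hε F hF using hα
  obtain ⟨δ, hδ, h⟩ := lebesgue_number_lemma_of_metric (c := fun x : K => Metric.ball (x : Y) (ε x))
    hK (fun _ => Metric.isOpen_ball)
    (fun x hx => mem_iUnion.2 ⟨⟨x, hx⟩, Metric.mem_ball_self (hε x hx)⟩)
  have hG : ∀ x ∈ K, ∃ G : Y → ℝ, ∀ y ∈ Metric.ball x δ, HasFDerivAt G (α y) y := fun x hx => by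
    obtain ⟨i, hi⟩ := h x hx
    exact ⟨F i, fun y hy => hF _ i.2 y (hi hy)⟩
  choose! G hG using hG
  exact ⟨δ, hδ, G, hG⟩

theorem primitive_sub_eq {α : Y → Y →L[ℝ] ℝ} {F G : Y → ℝ} {x x' : Y} {δ : ℝ}
    (hF : ∀ y ∈ Metric.ball x δ, HasFDerivAt F (α y) y)
    (hG : ∀ y ∈ Metric.ball x' δ, HasFDerivAt G (α y) y) {p q : Y}
    (hp : p ∈ Metric.ball x δ ∩ Metric.ball x' δ) (hq : q ∈ Metric.ball x δ ∩ Metric.ball x' δ) :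
    F q - F p = G q - G p := by
  have hconv := (convex_ball x δ).inter (convex_ball x' δ)
  have hd : ∀ y ∈ Metric.ball x δ ∩ Metric.ball x' δ, HasFDerivAt (fun z => F z - G z) 0 y :=
    fun y hy => by
    have := (hF y hy.1).sub (hG y hy.2)
    rw [sub_self] at this
    exact this
  have := hconv.is_const_of_fderivWithin_eq_zero (𝕜 := ℝ) (f := fun z => F z - G z)
    (fun y hy => (hd y hy).differentiableAt.differentiableWithinAt) (fun y hy => by
      rw [fderivWithin_of_isOpen (Metric.isOpen_ball.inter Metric.isOpen_ball) hy]
      exact (hd y hy).fderiv) hp hq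
  linarith

/-- The integral of a locally exact form along a closed curve that contracts to a point vanishes. -/
theorem LocallyExactOn.integral_eq_zero_of_contraction {α : Y → Y →L[ℝ] ℝ} {S : Set Y}
    (hα : LocallyExactOn α S) {L : ℝ} (hL : 0 ≤ L) {Q : ℝ → ℝ → Y}
    (hQ : Continuous (Function.uncurry Q)) (hQS : ∀ s θ, Q s θ ∈ S) {T : ℝ} (hT : 0 ≤ T)
    (hper : ∀ θ, Q 0 θ = Q L θ) {x₀ : Y} (h0 : ∀ s, Q s 0 = x₀) {γ γ' : ℝ → Y}
    (hγ : ∀ s, HasDerivAt γ (γ' s) s) (hend : ∀ s, Q s T = γ s)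
    (hint : Continuous fun s => α (γ s) (γ' s)) :
    ∫ s in (0 : ℝ)..L, α (γ s) (γ' s) = 0 := by
  have hKc : IsCompact (Icc (0 : ℝ) L ×ˢ Icc (0 : ℝ) T) := isCompact_Icc.prod isCompact_Icc
  set K := Function.uncurry Q '' (Icc (0 : ℝ) L ×ˢ Icc (0 : ℝ) T) with hK
  have hKS : K ⊆ S := by
    rintro _ ⟨⟨s, θ⟩, -, rfl⟩
    exact hQS s θ
  obtain ⟨δ, hδ, F, hF⟩ := LocallyExactOn.exists_uniform
    (fun x hx => hα x (hKS hx)) (hKc.image hQ)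
  have huc := hKc.uniformContinuousOn_of_continuous hQ.continuousOn
  rw [Metric.uniformContinuousOn_iff] at huc
  obtain ⟨η, hη, huc⟩ := huc (δ / 2) (by positivity)
  obtain ⟨n, hn⟩ := exists_nat_gt ((L + T) / η)
  have hn0 : 0 < (n : ℝ) := lt_of_le_of_lt (by positivity) hn
  have hLT : (L + T) / n < η := by
    rw [div_lt_iff₀ hn0]
    rw [div_lt_iff₀ hη] at hn
    linarith
  let σ : ℕ → ℝ := fun i => i * (L / n)
  let τ : ℕ → ℝ := fun j => j * (T / n)
  have hσm : ∀ i ≤ n, σ i ∈ Icc (0 : ℝ) L := fun i hi => by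
    have : (i : ℝ) ≤ n := by exact_mod_cast hi
    refine ⟨by positivity, ?_⟩
    calc σ i ≤ n * (L / n) := by simp only [σ]; gcongr
      _ = L := by field_simp
  have hτm : ∀ i ≤ n, τ i ∈ Icc (0 : ℝ) T := fun i hi => by
    have : (i : ℝ) ≤ n := by exact_mod_cast hi
    refine ⟨by positivity, ?_⟩
    calc τ i ≤ n * (T / n) := by simp only [τ]; gcongr
      _ = T := by field_simp
  have hclose : ∀ s ∈ Icc (0 : ℝ) L, ∀ s' ∈ Icc (0 : ℝ) L, ∀ θ ∈ Icc (0 : ℝ) T,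
      ∀ θ' ∈ Icc (0 : ℝ) T, |s - s'| ≤ L / n → |θ - θ'| ≤ T / n →
      dist (Q s θ) (Q s' θ') < δ / 2 := fun s hs s' hs' θ hθ θ' hθ' h1 h2 => by
    refine huc (s, θ) ⟨hs, hθ⟩ (s', θ') ⟨hs', hθ'⟩ ?_
    rw [Prod.dist_eq, Real.dist_eq, Real.dist_eq]
    have e : (L + T) / n = L / n + T / n := by ring
    have h3 : 0 ≤ L / n := by positivity
    have h4 : 0 ≤ T / n := by positivity
    exact max_lt (by linarith) (by linarith)
  let J : Y → Y → ℝ := fun p q => F p q - F p p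
  have hJ : ∀ p ∈ K, ∀ q ∈ K, ∀ r, dist p q < δ / 2 → dist q r < δ / 2 →
      J p r = J p q + J q r := fun p hp q hq r h1 h2 => by
    have h3 : dist p r < δ := (dist_triangle p q r).trans_lt (by linarith)
    have := primitive_sub_eq (hF p hp) (hF q hq) (p := q) (q := r)
      ⟨by rw [Metric.mem_ball, dist_comm]; linarith, Metric.mem_ball_self hδ⟩
      ⟨by rw [Metric.mem_ball, dist_comm]; linarith, by rw [Metric.mem_ball, dist_comm]; linarith⟩
    simp only [J]
    linarith
  let P : ℕ → ℕ → Y := fun i j => Q (σ i) (τ j)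
  have hPK : ∀ i ≤ n, ∀ j ≤ n, P i j ∈ K := fun i hi j hj =>
    ⟨(σ i, τ j), ⟨hσm i hi, hτm j hj⟩, rfl⟩
  have hstep : ∀ i i' j j', i ≤ n → i' ≤ n → j ≤ n → j' ≤ n → (i' = i ∨ i' = i + 1) →
      (j' = j ∨ j' = j + 1) → dist (P i j) (P i' j') < δ / 2 := by
    intro i i' j j' hi hi' hj hj' h h'
    refine hclose _ (hσm i hi) _ (hσm i' hi') _ (hτm j hj) _ (hτm j' hj') ?_ ?_
    · rcases h with rfl | rfl
      · simp only [sub_self, abs_zero]; positivity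
      · have : σ i - σ (i + 1) = -(L / n) := by simp only [σ]; push_cast; ring
        rw [this, abs_neg, abs_of_nonneg (by positivity)]
    · rcases h' with rfl | rfl
      · simp only [sub_self, abs_zero]; positivity
      · have : τ j - τ (j + 1) = -(T / n) := by simp only [τ]; push_cast; ring
        rw [this, abs_neg, abs_of_nonneg (by positivity)]
  have hsum : ∀ j < n, ∑ i ∈ Finset.range n, J (P i j) (P (i + 1) j) =
      ∑ i ∈ Finset.range n, J (P i (j + 1)) (P (i + 1) (j + 1)) := fun j hj => by
    have hcell : ∀ i ∈ Finset.range n,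
        J (P i (j + 1)) (P (i + 1) (j + 1)) - J (P i j) (P (i + 1) j) =
          J (P (i + 1) j) (P (i + 1) (j + 1)) - J (P i j) (P i (j + 1)) := fun i hi => by
      have hi := Finset.mem_range.1 hi
      have e1 := hJ (P i j) (hPK i hi.le j hj.le) (P (i + 1) j) (hPK _ hi _ hj.le)
        (P (i + 1) (j + 1)) (hstep _ _ _ _ hi.le hi hj.le hj.le (by simp) (by simp))
        (hstep _ _ _ _ hi hi hj.le hj (by simp) (by simp))
      have e2 := hJ (P i j) (hPK i hi.le j hj.le) (P i (j + 1)) (hPK _ hi.le _ hj)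
        (P (i + 1) (j + 1)) (hstep _ _ _ _ hi.le hi.le hj.le hj (by simp) (by simp))
        (hstep _ _ _ _ hi.le hi hj hj (by simp) (by simp))
      linarith
    have htel := Finset.sum_range_sub (fun i => J (P i j) (P i (j + 1))) n
    rw [← Finset.sum_congr rfl hcell, Finset.sum_sub_distrib] at htel
    have hclosed : ∀ j, P n j = P 0 j := fun j => by
      have : σ n = L := by simp only [σ]; field_simp
      have h0' : σ 0 = 0 := by simp [σ]
      simp only [P, this, h0', hper]
    rw [hclosed, hclosed] at htel
    linarith
  have hall : ∀ j ≤ n, ∑ i ∈ Finset.range n, J (P i j) (P (i + 1) j) = 0 := by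
    intro j
    induction j with
    | zero =>
      intro _
      refine Finset.sum_eq_zero fun i _ => ?_
      have : ∀ i, P i 0 = x₀ := fun i => by simp [P, τ, h0]
      simp [this, J]
    | succ j ih =>
      intro hj
      rw [← hsum j hj, ih (by omega)]
  have hτn : τ n = T := by simp only [τ]; field_simp
  have hlast := hall n le_rfl
  have hpiece : ∀ i ∈ Finset.range n, J (P i n) (P (i + 1) n) =
      ∫ s in σ i..σ (i + 1), α (γ s) (γ' s) := fun i hi => by
    have hi := Finset.mem_range.1 hi
    have hmono : σ i ≤ σ (i + 1) := by simp only [σ]; gcongr; simp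
    have hder : ∀ s ∈ uIcc (σ i) (σ (i + 1)),
        HasDerivAt (fun s => F (P i n) (γ s)) (α (γ s) (γ' s)) s := fun s hs => by
      rw [uIcc_of_le hmono] at hs
      have hsm : s ∈ Icc (0 : ℝ) L := ⟨(hσm i hi.le).1.trans hs.1, hs.2.trans (hσm _ hi).2⟩
      have hd : dist (P i n) (Q s T) < δ / 2 := by
        refine hclose _ (hσm i hi.le) _ hsm _ (hτm n le_rfl) _ ⟨hT, le_rfl⟩ ?_ ?_
        · have : σ (i + 1) = σ i + L / n := by simp only [σ]; push_cast; ring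
          rw [abs_sub_comm, abs_of_nonneg (by linarith [hs.1])]
          linarith [hs.2]
        · rw [hτn, sub_self, abs_zero]; positivity
      rw [hend] at hd
      exact (hF (P i n) (hPK i hi.le n le_rfl) (γ s)
        (by rw [Metric.mem_ball, dist_comm]; linarith)).comp_hasDerivAt s (hγ s)
    rw [intervalIntegral.integral_eq_sub_of_hasDerivAt hder (hint.intervalIntegrable _ _)]
    simp only [J, P, hτn, hend]
  rw [Finset.sum_congr rfl hpiece,
    intervalIntegral.sum_integral_adjacent_intervals
      (fun i _ => hint.intervalIntegrable _ _)] at hlast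
  have hσn : σ n = L := by simp only [σ]; field_simp
  have hσ0 : σ 0 = 0 := by simp [σ]
  rwa [hσn, hσ0] at hlast

end Monodromy

section GaussForm

/-- Euclidean three-space. -/
abbrev Vec3 : Type := EuclideanSpace ℝ (Fin 3)

theorem det3_apply (a b c : Vec3) :
    det3 a b c = a 0 * (b 1 * c 2 - b 2 * c 1) + a 1 * (b 2 * c 0 - b 0 * c 2) +
      a 2 * (b 0 * c 1 - b 1 * c 0) := by
  simp [det3, Matrix.det_fin_three]
  ring

/-- The determinant `det3 v b c` as a bilinear map in `b` and `c` with values in linear forms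
in `v`. -/
def detForm : Vec3 →L[ℝ] Vec3 →L[ℝ] Vec3 →L[ℝ] ℝ :=
  LinearMap.toContinuousLinearMap
    { toFun := fun b => LinearMap.toContinuousLinearMap
        { toFun := fun c => LinearMap.toContinuousLinearMap
            { toFun := fun v => det3 v b c
              map_add' := fun x y => by simp [det3_apply]; ring
              map_smul' := fun r x => by simp [det3_apply]; ring }
          map_add' := fun x y => by ext v; simp [det3_apply]; ring
          map_smul' := fun r x => by ext v; simp [det3_apply]; ring }
      map_add' := fun x y => by ext c v; simp [det3_apply]; ring
      map_smul' := fun r x => by ext c v; simp [det3_apply]; ring }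

@[simp]
theorem detForm_apply (b c v : Vec3) : detForm b c v = det3 v b c := rfl

/-- The Newtonian field `z / ‖z‖ ^ 3`. -/
def newtonField (z : Vec3) : Vec3 := (‖z‖ ^ 3)⁻¹ • z

/-- The derivative of the Newtonian field. -/
def newtonDeriv (z : Vec3) : Vec3 →L[ℝ] Vec3 :=
  (‖z‖ ^ 3)⁻¹ • ContinuousLinearMap.id ℝ Vec3 - (3 * (‖z‖ ^ 5)⁻¹) • (innerSL ℝ z).smulRight z

theorem hasFDerivAt_newtonField {z : Vec3} (hz : z ≠ 0) :
    HasFDerivAt newtonField (newtonDeriv z) z := by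
  have hz' : ‖z‖ ≠ 0 := norm_ne_zero_iff.2 hz
  have h1 : HasFDerivAt (fun w : Vec3 => ‖w‖) (‖z‖⁻¹ • innerSL ℝ z) z := by
    have h := (hasStrictFDerivAt_norm_sq z).hasFDerivAt.sqrt (pow_ne_zero 2 hz')
    simp only [Real.sqrt_sq (norm_nonneg _)] at h
    refine h.congr_fderiv ?_
    ext v
    simp
    field_simp
  have h2 := ((hasDerivAt_inv (pow_ne_zero 3 hz')).comp_hasFDerivAt z (h1.pow 3)).smul
    (hasFDerivAt_id z)
  refine h2.congr_fderiv ?_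
  ext v
  simp [newtonDeriv]
  field_simp
  ring

theorem continuousOn_newtonField : ContinuousOn newtonField {0}ᶜ := fun _ hz =>
  (hasFDerivAt_newtonField hz).continuousAt.continuousWithinAt

theorem continuousOn_newtonDeriv : ContinuousOn newtonDeriv {0}ᶜ := by
  unfold newtonDeriv
  have h : ∀ n, ContinuousOn (fun z : Vec3 => (‖z‖ ^ n)⁻¹) {0}ᶜ := fun n =>
    ContinuousOn.inv₀ (by fun_prop) fun _ hz => pow_ne_zero n (norm_ne_zero_iff.2 hz)
  refine ((h 3).smul continuousOn_const).sub (((h 5).const_mul 3).smul ?_)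
  have : Continuous fun z : Vec3 =>
      (ContinuousLinearMap.smulRightL ℝ Vec3 Vec3 (innerSL ℝ z)) z := by
    fun_prop
  exact this.continuousOn

theorem det3_newtonDeriv_sub {z : Vec3} (hz : z ≠ 0) (b v w : Vec3) :
    det3 v b (newtonDeriv z w) - det3 w b (newtonDeriv z v) =
      det3 (newtonDeriv z b) v w := by
  have hz' : ‖z‖ ≠ 0 := norm_ne_zero_iff.2 hz
  have e : ‖z‖ ^ 2 = z 0 ^ 2 + z 1 ^ 2 + z 2 ^ 2 := by
    rw [EuclideanSpace.norm_sq_eq, Fin.sum_univ_three]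
    simp
  have e3 : (‖z‖ ^ 3)⁻¹ = (z 0 ^ 2 + z 1 ^ 2 + z 2 ^ 2) * (‖z‖ ^ 5)⁻¹ := by
    rw [← e]
    field_simp
  simp only [det3_apply, newtonDeriv, e3]
  simp [PiLp.inner_apply, Fin.sum_univ_three]
  ring

/-- The one-form obtained by integrating the Gauss kernel along a curve. -/
def gaussForm (γ γ' : ℝ → Vec3) (T : ℝ) (x : Vec3) : Vec3 →L[ℝ] ℝ :=
  ∫ t in (0 : ℝ)..T, detForm (γ' t) (newtonField (x - γ t))

variable {γ γ' : ℝ → Vec3} {T : ℝ}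

theorem continuousOn_gaussForm_integrand (hγ : Continuous γ) (hγ' : Continuous γ') :
    ContinuousOn (Function.uncurry fun x t => detForm (γ' t) (newtonField (x - γ t)))
      ((range γ)ᶜ ×ˢ univ) := by
  have h : ContinuousOn (fun p : Vec3 × ℝ => newtonField (p.1 - γ p.2)) ((range γ)ᶜ ×ˢ univ) :=
    continuousOn_newtonField.comp (by fun_prop) fun p hp h0 => hp.1 ⟨p.2, (sub_eq_zero.1 h0).symm⟩
  have h' : Continuous fun p : Vec3 × ℝ => detForm (γ' p.2) := by fun_prop
  exact h'.continuousOn.clm_apply h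

theorem gaussForm_apply (hγ : Continuous γ) (hγ' : Continuous γ') {x : Vec3} (hx : x ∉ range γ)
    (v : Vec3) :
    gaussForm γ γ' T x v = ∫ t in (0 : ℝ)..T, det3 v (γ' t) (x - γ t) / ‖x - γ t‖ ^ 3 := by
  rw [gaussForm, ContinuousLinearMap.intervalIntegral_apply
    ((continuous_section_of_continuousOn_prod
      (continuousOn_gaussForm_integrand hγ hγ') hx).intervalIntegrable _ _)]
  refine intervalIntegral.integral_congr fun t _ => ?_
  simp only [detForm_apply, newtonField, det3_apply]
  simp
  ring

theorem continuousOn_gaussForm (hγ : Continuous γ) (hγ' : Continuous γ') :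
    ContinuousOn (gaussForm γ γ' T) (range γ)ᶜ :=
  continuousOn_intervalIntegral_of_continuousOn_prod (continuousOn_gaussForm_integrand hγ hγ') 0 T

theorem gaussForm_locallyExactOn (hγ : ∀ t, HasDerivAt γ (γ' t) t) (hγ' : Continuous γ')
    (hT : γ 0 = γ T) (hcl : IsClosed (range γ)) :
    LocallyExactOn (gaussForm γ γ' T) (range γ)ᶜ := by
  have hγc : Continuous γ := continuous_iff_continuousAt.2 fun t => (hγ t).continuousAt
  have hne : ∀ x ∈ (range γ)ᶜ, ∀ t, x - γ t ≠ 0 := fun x hx t h =>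
    hx ⟨t, (sub_eq_zero.1 h).symm⟩
  have hcont' : ContinuousOn (Function.uncurry fun x t =>
      (detForm (γ' t)).comp (newtonDeriv (x - γ t))) ((range γ)ᶜ ×ˢ univ) := by
    have h : ContinuousOn (fun p : Vec3 × ℝ => newtonDeriv (p.1 - γ p.2)) ((range γ)ᶜ ×ˢ univ) :=
      continuousOn_newtonDeriv.comp (by fun_prop) fun p hp => hne _ hp.1 _
    have h' : Continuous fun p : Vec3 × ℝ => detForm (γ' p.2) := by fun_prop
    exact h'.continuousOn.clm_comp h
  have hder : ∀ x ∈ (range γ)ᶜ, HasFDerivAt (gaussForm γ γ' T)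
      (∫ t in (0 : ℝ)..T, (detForm (γ' t)).comp (newtonDeriv (x - γ t))) x := fun x hx =>
    hasFDerivAt_intervalIntegral_of_continuousOn_prod hcl.isOpen_compl
      (continuousOn_gaussForm_integrand hγc hγ') hcont' (fun y hy t =>
        (detForm (γ' t)).hasFDerivAt.comp y
          ((hasFDerivAt_comp_sub (γ t)).2 (hasFDerivAt_newtonField (hne y hy t)))) 0 T hx
  have hsymm : ∀ x ∈ (range γ)ᶜ, ∀ v w,
      (∫ t in (0 : ℝ)..T, (detForm (γ' t)).comp (newtonDeriv (x - γ t))) w v =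
        (∫ t in (0 : ℝ)..T, (detForm (γ' t)).comp (newtonDeriv (x - γ t))) v w := by
    intro x hx v w
    have hc := continuous_section_of_continuousOn_prod hcont' hx
    have happ : ∀ a b, (∫ t in (0 : ℝ)..T, (detForm (γ' t)).comp (newtonDeriv (x - γ t))) a b =
        ∫ t in (0 : ℝ)..T, det3 b (γ' t) (newtonDeriv (x - γ t) a) := fun a b => by
      rw [ContinuousLinearMap.intervalIntegral_apply (hc.intervalIntegrable _ _),
        ContinuousLinearMap.intervalIntegral_apply
          ((hc.clm_apply continuous_const).intervalIntegrable _ _)]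
      rfl
    have hcab : ∀ a b, Continuous fun t => det3 b (γ' t) (newtonDeriv (x - γ t) a) := fun a b =>
      (hc.clm_apply (continuous_const (y := a))).clm_apply (continuous_const (y := b))
    rw [happ, happ, ← sub_eq_zero, ← intervalIntegral.integral_sub
      ((hcab _ _).intervalIntegrable _ _) ((hcab _ _).intervalIntegrable _ _)]
    have hprim : ∀ t, HasDerivAt (fun t => -detForm v w (newtonField (x - γ t)))
        (det3 v (γ' t) (newtonDeriv (x - γ t) w) - det3 w (γ' t) (newtonDeriv (x - γ t) v)) t :=
      fun t => by
        have h := ((detForm v w).hasFDerivAt.comp_hasDerivAt t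
          ((hasFDerivAt_newtonField (hne x hx t)).comp_hasDerivAt t ((hγ t).const_sub x))).neg
        refine h.congr_deriv ?_
        rw [det3_newtonDeriv_sub (hne x hx t), map_neg, map_neg, neg_neg, detForm_apply]
    rw [intervalIntegral.integral_eq_sub_of_hasDerivAt (fun t _ => hprim t)
      (((hcab _ _).sub (hcab _ _)).intervalIntegrable _ _), hT, sub_self]
  intro x hx
  obtain ⟨ε, hε, hball⟩ := Metric.isOpen_iff.1 hcl.isOpen_compl x hx
  obtain ⟨f, hf⟩ := (convex_ball x ε).exists_forall_hasFDerivAt_of_fderiv_symmetric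
    Metric.isOpen_ball
    (fun y hy => (hder y (hball hy)).differentiableAt.differentiableWithinAt)
    (fun y hy v w => by rw [(hder y (hball hy)).fderiv]; exact hsymm y (hball hy) _ _)
  exact ⟨ε, hε, f, hf⟩

end GaussForm

section VisualLength

open scoped RealInnerProductSpace

variable {V : Type*} [NormedAddCommGroup V]

/-- The squared distance from `x` to the point of the upper half-space with coordinates `a`. -/
def heightDist (a : V × ℝ) (x : V) : ℝ := ‖x - a.1‖ ^ 2 + a.2 ^ 2

theorem heightDist_pos {a : V × ℝ} (ha : 0 < a.2) (x : V) : 0 < heightDist a x := by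
  unfold heightDist
  positivity

theorem heightDist_nonneg (a : V × ℝ) (x : V) : 0 ≤ heightDist a x := by
  unfold heightDist
  positivity

@[fun_prop]
theorem continuous_heightDist : Continuous fun p : (V × ℝ) × V => heightDist p.1 p.2 := by
  unfold heightDist
  fun_prop

/-- The conformal density at `x` of the visual metric seen from `a`. -/
def visDensity (a : V × ℝ) (x : V) : ℝ := 2 * a.2 / heightDist a x

theorem continuousOn_visDensity {γ : ℝ → V} (hγ : Continuous γ) :
    ContinuousOn (fun p : (V × ℝ) × ℝ => visDensity p.1 (γ p.2))
      {p | heightDist p.1 (γ p.2) ≠ 0} := by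
  have h : Continuous fun p : (V × ℝ) × ℝ => heightDist p.1 (γ p.2) := by
    unfold heightDist
    fun_prop
  exact ContinuousOn.div (by fun_prop) h.continuousOn fun p hp => hp

/-- The points at which the visual length of a curve is well behaved. -/
def visDomain (γ : ℝ → V) : Set (V × ℝ) := {a | ∀ t, heightDist a (γ t) ≠ 0}

theorem mem_visDomain_of_pos {γ : ℝ → V} {a : V × ℝ} (ha : 0 < a.2) : a ∈ visDomain γ :=
  fun _ => (heightDist_pos ha _).ne'

variable [InnerProductSpace ℝ V]

/-- The Euclidean pairing on `V × ℝ`. -/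
def pairing (g : V × ℝ) : V × ℝ →L[ℝ] ℝ :=
  (innerSL ℝ g.1).comp (ContinuousLinearMap.fst ℝ V ℝ) + g.2 • ContinuousLinearMap.snd ℝ V ℝ

theorem pairing_apply (g v : V × ℝ) : pairing g v = ⟪g.1, v.1⟫ + g.2 * v.2 := by
  simp [pairing]

theorem pairing_comm (g v : V × ℝ) : pairing g v = pairing v g := by
  rw [pairing_apply, pairing_apply, real_inner_comm, mul_comm]

theorem continuous_pairing : Continuous (pairing : V × ℝ → V × ℝ →L[ℝ] ℝ) := by
  unfold pairing
  fun_prop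

/-- The gradient of `visDensity` in the first variable. -/
def visDensityGrad (a : V × ℝ) (x : V) : V × ℝ :=
  ((4 * a.2 / heightDist a x ^ 2) • (x - a.1),
    2 * (‖x - a.1‖ ^ 2 - a.2 ^ 2) / heightDist a x ^ 2)

theorem hasFDerivAt_visDensity {a : V × ℝ} {x : V} (h : heightDist a x ≠ 0) :
    HasFDerivAt (fun b => visDensity b x) (pairing (visDensityGrad a x)) a := by
  have h1 : HasFDerivAt (fun b : V × ℝ => x - b.1) (-ContinuousLinearMap.fst ℝ V ℝ) a :=
    hasFDerivAt_fst.const_sub x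
  have h2 : HasFDerivAt (fun b : V × ℝ => b.2) (ContinuousLinearMap.snd ℝ V ℝ) a := hasFDerivAt_snd
  have h3 := (h2.const_mul 2).mul
    ((hasDerivAt_inv h).comp_hasFDerivAt a (h1.norm_sq.add (h2.pow 2)))
  refine h3.congr_fderiv ?_
  ext v
  · simp [pairing, visDensityGrad]
    field_simp
    ring
  · simp [pairing, visDensityGrad]
    have : heightDist a x = ‖x - a.1‖ ^ 2 + a.2 ^ 2 := rfl
    rw [← this]
    field_simp
    rw [this]
    ring

/-- The length of a curve in the visual metric seen from a point of the upper half-space. -/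
def visLength (γ : ℝ → V) (a : V × ℝ) : ℝ :=
  ∫ t in (0 : ℝ)..2 * π, ‖deriv γ t‖ * visDensity a (γ t)

/-- The gradient of the visual length. -/
def visGrad (γ : ℝ → V) (a : V × ℝ) : V × ℝ :=
  ∫ t in (0 : ℝ)..2 * π, ‖deriv γ t‖ • visDensityGrad a (γ t)

variable {γ : ℝ → V}

theorem continuousOn_visDensityGrad (hγ : Continuous γ) :
    ContinuousOn (fun p : (V × ℝ) × ℝ => visDensityGrad p.1 (γ p.2))
      {p | heightDist p.1 (γ p.2) ≠ 0} := by
  have h : Continuous fun p : (V × ℝ) × ℝ => heightDist p.1 (γ p.2) := by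
    unfold heightDist
    fun_prop
  refine ContinuousOn.prodMk ?_ ?_
  · exact (ContinuousOn.div (by fun_prop) (h.pow 2).continuousOn
      fun p hp => pow_ne_zero 2 hp).smul (by fun_prop)
  · exact ContinuousOn.div (by fun_prop) (h.pow 2).continuousOn fun p hp => pow_ne_zero 2 hp

theorem continuousOn_visLength_integrand (hγ : ContDiff ℝ 1 γ) :
    ContinuousOn (Function.uncurry fun a t => ‖deriv γ t‖ * visDensity a (γ t))
      (visDomain γ ×ˢ univ) := by
  have h : Continuous fun p : (V × ℝ) × ℝ => ‖deriv γ p.2‖ :=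
    ((hγ.continuous_deriv le_rfl).comp continuous_snd).norm
  exact h.continuousOn.mul ((continuousOn_visDensity hγ.continuous).mono fun p hp => hp.1 p.2)

theorem continuousOn_visGrad_integrand (hγ : ContDiff ℝ 1 γ) :
    ContinuousOn (Function.uncurry fun a t => ‖deriv γ t‖ • visDensityGrad a (γ t))
      (visDomain γ ×ˢ univ) := by
  have h : Continuous fun p : (V × ℝ) × ℝ => ‖deriv γ p.2‖ :=
    ((hγ.continuous_deriv le_rfl).comp continuous_snd).norm
  exact h.continuousOn.smul ((continuousOn_visDensityGrad hγ.continuous).mono fun p hp => hp.1 p.2)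

theorem continuousOn_visLength (hγ : ContDiff ℝ 1 γ) :
    ContinuousOn (visLength γ) (visDomain γ) :=
  continuousOn_intervalIntegral_of_continuousOn_prod (continuousOn_visLength_integrand hγ) _ _

theorem continuousOn_visGrad (hγ : ContDiff ℝ 1 γ) :
    ContinuousOn (visGrad γ) (visDomain γ) :=
  continuousOn_intervalIntegral_of_continuousOn_prod (continuousOn_visGrad_integrand hγ) _ _

theorem pairing_visGrad [CompleteSpace V] (hγ : ContDiff ℝ 1 γ) {a : V × ℝ} (ha : a ∈ visDomain γ)
    (v : V × ℝ) :
    pairing (visGrad γ a) v =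
      ∫ t in (0 : ℝ)..2 * π, ‖deriv γ t‖ * pairing (visDensityGrad a (γ t)) v := by
  rw [pairing_comm, visGrad, ← ContinuousLinearMap.intervalIntegral_comp_comm _
    ((continuous_section_of_continuousOn_prod
      (continuousOn_visGrad_integrand hγ) ha).intervalIntegrable _ _)]
  refine intervalIntegral.integral_congr fun t _ => ?_
  change pairing v (_ • _) = _
  rw [map_smul, smul_eq_mul, pairing_comm]

theorem hasFDerivAt_visLength [CompleteSpace V] (hγ : ContDiff ℝ 1 γ) {a : V × ℝ} (ha : 0 < a.2) :
    HasFDerivAt (visLength γ) (pairing (visGrad γ a)) a := by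
  have hsub : {b : V × ℝ | 0 < b.2} ⊆ visDomain γ := fun b hb => mem_visDomain_of_pos hb
  have hcont : ContinuousOn (Function.uncurry fun a t =>
      pairing (‖deriv γ t‖ • visDensityGrad a (γ t))) ({b : V × ℝ | 0 < b.2} ×ˢ univ) :=
    continuous_pairing.comp_continuousOn ((continuousOn_visGrad_integrand hγ).mono
      (prod_mono hsub subset_rfl))
  have h := hasFDerivAt_intervalIntegral_of_continuousOn_prod
    (f := fun a t => ‖deriv γ t‖ * visDensity a (γ t))
    (isOpen_lt continuous_const continuous_snd)
    ((continuousOn_visLength_integrand hγ).mono (prod_mono hsub subset_rfl)) hcont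
    (fun b hb t => by
      refine ((hasFDerivAt_visDensity (heightDist_pos hb (γ t)).ne').const_mul
        ‖deriv γ t‖).congr_fderiv ?_
      ext v <;> simp [pairing_apply, inner_smul_left]) 0 (2 * π) ha
  refine h.congr_fderiv ?_
  refine ContinuousLinearMap.ext fun v => ?_
  rw [ContinuousLinearMap.intervalIntegral_apply
    ((continuous_section_of_continuousOn_prod hcont ha).intervalIntegrable _ _),
    pairing_visGrad hγ (mem_visDomain_of_pos ha)]
  refine intervalIntegral.integral_congr fun t _ => ?_
  change pairing (_ • _) v = _
  rw [pairing_comm, map_smul, smul_eq_mul, pairing_comm]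

theorem visDensity_mul_add_pairing_le {a : V × ℝ} (ha : 0 < a.2) {x y : V} (hxy : x ≠ y) :
    (visDensity a x * visDensity a y +
      a.2 ^ 2 * pairing (visDensityGrad a x) (visDensityGrad a y)) / 2 ≤ 1 / ‖x - y‖ ^ 2 := by
  have hn : 0 < ‖x - y‖ := norm_sub_pos_iff.2 hxy
  have hD := heightDist_pos ha x
  have hD' := heightDist_pos ha y
  have e : ‖x - y‖ ^ 2 = ‖x - a.1‖ ^ 2 + ‖y - a.1‖ ^ 2 - 2 * ⟪x - a.1, y - a.1⟫ := by
    rw [← sub_sub_sub_cancel_right x y a.1, norm_sub_sq_real]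
    ring
  have key : (visDensity a x * visDensity a y +
      a.2 ^ 2 * pairing (visDensityGrad a x) (visDensityGrad a y)) / 2 =
      4 * a.2 ^ 2 * (heightDist a x * heightDist a y - a.2 ^ 2 * ‖x - y‖ ^ 2) /
        (heightDist a x * heightDist a y) ^ 2 := by
    simp only [visDensity, visDensityGrad, pairing_apply, inner_smul_left, inner_smul_right,
      conj_trivial]
    have h1 : ‖x - a.1‖ ^ 2 = heightDist a x - a.2 ^ 2 := by simp [heightDist]
    have h2 : ‖y - a.1‖ ^ 2 = heightDist a y - a.2 ^ 2 := by simp [heightDist]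
    rw [e, h1, h2]
    field_simp
    ring
  rw [key, div_le_div_iff₀ (by positivity) (by positivity)]
  nlinarith [sq_nonneg (heightDist a x * heightDist a y - 2 * a.2 ^ 2 * ‖x - y‖ ^ 2)]

/-- The Möbius cross energy bounds the visual lengths and the product of their gradients. -/
theorem visLength_mul_add_pairing_le [CompleteSpace V] {γ₁ γ₂ : ℝ → V} (h₁ : ContDiff ℝ 1 γ₁)
    (h₂ : ContDiff ℝ 1 γ₂) (hdisj : ∀ s t, γ₁ s ≠ γ₂ t) {a : V × ℝ} (ha : 0 < a.2) :
    visLength γ₁ a * visLength γ₂ a + a.2 ^ 2 * pairing (visGrad γ₁ a) (visGrad γ₂ a) ≤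
      2 * mobiusEnergy γ₁ γ₂ := by
  have hd₁ := h₁.continuous_deriv le_rfl
  have hd₂ := h₂.continuous_deriv le_rfl
  have hc₁ := h₁.continuous
  have hc₂ := h₂.continuous
  have hω : ∀ {γ : ℝ → V}, Continuous γ → Continuous fun t => visDensity a (γ t) := fun hγ =>
    (continuousOn_visDensity hγ).comp_continuous (f := fun t => (a, t)) (by fun_prop)
      fun t => (heightDist_pos ha _).ne'
  have hg : ∀ {γ : ℝ → V}, Continuous γ → Continuous fun t => visDensityGrad a (γ t) := fun hγ =>
    (continuousOn_visDensityGrad hγ).comp_continuous (f := fun t => (a, t)) (by fun_prop)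
      fun t => (heightDist_pos ha _).ne'
  have hω₁ := hω hc₁
  have hω₂ := hω hc₂
  have hg₁ := hg hc₁
  have hg₂ := hg hc₂
  have hpair : Continuous fun p : ℝ × ℝ =>
      pairing (visDensityGrad a (γ₁ p.1)) (visDensityGrad a (γ₂ p.2)) :=
    (continuous_pairing.comp (hg₁.comp continuous_fst)).clm_apply (hg₂.comp continuous_snd)
  let A : ℝ → ℝ → ℝ := fun s t =>
    (‖deriv γ₁ s‖ * visDensity a (γ₁ s)) * (‖deriv γ₂ t‖ * visDensity a (γ₂ t))
  let B : ℝ → ℝ → ℝ := fun s t => ‖deriv γ₁ s‖ * (‖deriv γ₂ t‖ *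
    pairing (visDensityGrad a (γ₁ s)) (visDensityGrad a (γ₂ t)))
  have hA : Continuous (Function.uncurry A) :=
    ((hd₁.norm.mul hω₁).comp continuous_fst).mul ((hd₂.norm.mul hω₂).comp continuous_snd)
  have hB : Continuous (Function.uncurry B) := by
    change Continuous fun p : ℝ × ℝ => ‖deriv γ₁ p.1‖ * (‖deriv γ₂ p.2‖ *
      pairing (visDensityGrad a (γ₁ p.1)) (visDensityGrad a (γ₂ p.2)))
    fun_prop
  have hL : visLength γ₁ a * visLength γ₂ a =
      ∫ s in (0 : ℝ)..2 * π, ∫ t in (0 : ℝ)..2 * π, A s t := by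
    simp only [A, intervalIntegral.integral_const_mul, intervalIntegral.integral_mul_const]
    rfl
  have hP : pairing (visGrad γ₁ a) (visGrad γ₂ a) =
      ∫ s in (0 : ℝ)..2 * π, ∫ t in (0 : ℝ)..2 * π, B s t := by
    rw [pairing_visGrad h₁ (mem_visDomain_of_pos ha)]
    refine intervalIntegral.integral_congr fun s _ => ?_
    simp only [B, intervalIntegral.integral_const_mul]
    rw [pairing_comm, pairing_visGrad h₂ (mem_visDomain_of_pos ha)]
    simp only [pairing_comm (visDensityGrad a (γ₁ s))]
  have hE : Continuous (Function.uncurry fun s t =>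
      ‖deriv γ₁ s‖ * ‖deriv γ₂ t‖ / ‖γ₁ s - γ₂ t‖ ^ 2) := by
    change Continuous fun p : ℝ × ℝ => ‖deriv γ₁ p.1‖ * ‖deriv γ₂ p.2‖ / ‖γ₁ p.1 - γ₂ p.2‖ ^ 2
    exact Continuous.div (by fun_prop) (by fun_prop) fun p =>
      pow_ne_zero 2 (norm_ne_zero_iff.2 (sub_ne_zero.2 (hdisj _ _)))
  have hout : ∀ {f : ℝ → ℝ → ℝ}, Continuous (Function.uncurry f) →
      IntervalIntegrable (fun s => ∫ t in (0 : ℝ)..2 * π, f s t) volume 0 (2 * π) := fun hf =>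
    (intervalIntegral.continuous_parametric_intervalIntegral_of_continuous'
      hf _ _).intervalIntegrable
      _ _
  have hin : ∀ {f : ℝ → ℝ → ℝ}, Continuous (Function.uncurry f) → ∀ s,
      IntervalIntegrable (f s) volume 0 (2 * π) := fun hf s =>
    (hf.comp (Continuous.prodMk_right s)).intervalIntegrable _ _
  have hcomb : visLength γ₁ a * visLength γ₂ a +
      a.2 ^ 2 * pairing (visGrad γ₁ a) (visGrad γ₂ a) =
      ∫ s in (0 : ℝ)..2 * π, ∫ t in (0 : ℝ)..2 * π, (A s t + a.2 ^ 2 * B s t) := by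
    rw [hL, hP, ← intervalIntegral.integral_const_mul, ← intervalIntegral.integral_add (hout hA)
      ((hout hB).const_mul _)]
    refine intervalIntegral.integral_congr fun s _ => ?_
    rw [intervalIntegral.integral_add (hin hA s) ((hin hB s).const_mul _),
      intervalIntegral.integral_const_mul (a.2 ^ 2)]
  have hAB : Continuous (Function.uncurry fun s t => A s t + a.2 ^ 2 * B s t) := by
    change Continuous fun p : ℝ × ℝ => Function.uncurry A p + a.2 ^ 2 * Function.uncurry B p
    fun_prop
  have hE2 : Continuous (Function.uncurry fun s t =>
      2 * (‖deriv γ₁ s‖ * ‖deriv γ₂ t‖ / ‖γ₁ s - γ₂ t‖ ^ 2)) := hE.const_mul 2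
  rw [hcomb, mobiusEnergy, ← intervalIntegral.integral_const_mul]
  simp only [← intervalIntegral.integral_const_mul]
  refine intervalIntegral.integral_mono_on (by positivity) (hout hAB) (hout hE2) fun s _ => ?_
  refine intervalIntegral.integral_mono_on (by positivity) (hin hAB s) (hin hE2 s) fun t _ => ?_
  have h := visDensity_mul_add_pairing_le ha (hdisj s t)
  have hw : 0 ≤ ‖deriv γ₁ s‖ * ‖deriv γ₂ t‖ := by positivity
  have := mul_le_mul_of_nonneg_left h hw
  calc A s t + a.2 ^ 2 * B s t = 2 * (‖deriv γ₁ s‖ * ‖deriv γ₂ t‖ *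
        ((visDensity a (γ₁ s) * visDensity a (γ₂ t) + a.2 ^ 2 *
          pairing (visDensityGrad a (γ₁ s)) (visDensityGrad a (γ₂ t))) / 2)) := by
        simp only [A, B]
        ring
    _ ≤ 2 * (‖deriv γ₁ s‖ * ‖deriv γ₂ t‖ * (1 / ‖γ₁ s - γ₂ t‖ ^ 2)) := by linarith
    _ = _ := by ring

end VisualLength

section Antipodal

open scoped RealInnerProductSpace

variable {V : Type*} [NormedAddCommGroup V] [InnerProductSpace ℝ V]

/-- The points of the hyperbolic geodesic joining the ideal points `p` and `q`. -/
def geodesicPoint (p q : V) (μ : ℝ) : V × ℝ :=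
  (p + μ • (q - p), √(μ * (1 - μ)) * ‖q - p‖)

theorem heightDist_geodesicPoint (p q x : V) {μ : ℝ} (h0 : 0 ≤ μ) (h1 : μ ≤ 1) :
    heightDist (geodesicPoint p q μ) x = (1 - μ) * ‖x - p‖ ^ 2 + μ * ‖x - q‖ ^ 2 := by
  have hs : √(μ * (1 - μ)) ^ 2 = μ * (1 - μ) :=
    Real.sq_sqrt (mul_nonneg h0 (sub_nonneg.2 h1))
  have e1 : x - (p + μ • (q - p)) = (x - p) - μ • (q - p) := by abel
  have e2 : x - q = (x - p) - (q - p) := by abel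
  simp only [heightDist, geodesicPoint, mul_pow, hs]
  rw [e1, e2]
  generalize x - p = u, q - p = w
  rw [norm_sub_sq_real, norm_sub_sq_real, inner_smul_right, norm_smul, mul_pow,
    Real.norm_eq_abs, sq_abs]
  ring

theorem norm_sq_smul_sub_norm_sq_smul (u v : V) :
    ‖‖u‖ ^ 2 • v - ‖v‖ ^ 2 • u‖ = ‖u‖ * ‖v‖ * ‖u - v‖ := by
  rw [← sq_eq_sq₀ (norm_nonneg _) (by positivity), mul_pow, norm_sub_sq_real, norm_sub_sq_real,
    norm_smul, norm_smul, inner_smul_left, inner_smul_right, real_inner_comm]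
  simp
  ring

theorem sub_le_integral_of_abs_deriv_le {φ φ' g : ℝ → ℝ} (hg : Continuous g)
    (hφ : ∀ t, HasDerivAt φ (φ' t) t) (h : ∀ t, |φ' t| ≤ g t) {a b : ℝ} (hab : a ≤ b) :
    |φ b - φ a| ≤ ∫ t in a..b, g t := by
  have hG : ∀ t, HasDerivAt (fun t => ∫ τ in a..t, g τ) (g t) t := fun t =>
    intervalIntegral.integral_hasDerivAt_right (hg.intervalIntegrable _ _)
      (hg.stronglyMeasurableAtFilter _ _) hg.continuousAt
  have m1 : Monotone ((fun t => ∫ τ in a..t, g τ) - φ) :=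
    monotone_of_hasDerivAt_nonneg (fun t => (hG t).sub (hφ t))
      fun t => sub_nonneg.2 ((le_abs_self _).trans (h t))
  have m2 : Monotone ((fun t => ∫ τ in a..t, g τ) + φ) :=
    monotone_of_hasDerivAt_nonneg (fun t => (hG t).add (hφ t))
      fun t => by
        have := (neg_abs_le (φ' t))
        have := h t
        simp only [Pi.zero_apply]
        linarith
  have h1 := m1 hab
  have h2 := m2 hab
  simp only [Pi.sub_apply, Pi.add_apply, intervalIntegral.integral_same] at h1 h2
  rw [abs_le]
  constructor <;> linarith

variable {γ : ℝ → V}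

/-- Half of a closed curve through `p` and `q` has visual length at least `π` on the geodesic
from `p` to `q`. -/
theorem two_mul_arcsin_le_integral (hγ : ContDiff ℝ 1 γ) {s₀ s₁ : ℝ} (hne : γ s₀ ≠ γ s₁)
    {μ : ℝ} (h0 : 0 < μ) (h1 : μ < 1) {a b : ℝ} (hab : a ≤ b) {r : ℝ} (hr0 : 0 < r) (hr1 : r < 1)
    (hends : γ a = γ s₀ ∧ γ b = γ s₁ ∨ γ a = γ s₁ ∧ γ b = γ s₀) :
    2 * arcsin r ≤
      ∫ t in a..b, ‖deriv γ t‖ * visDensity (geodesicPoint (γ s₀) (γ s₁) μ) (γ t) := by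
  set p := γ s₀
  set q := γ s₁
  have hpq : 0 < ‖q - p‖ := norm_sub_pos_iff.2 hne.symm
  have hμ : 0 < μ * (1 - μ) := mul_pos h0 (sub_pos.2 h1)
  have hh : 0 < (geodesicPoint p q μ).2 := mul_pos (Real.sqrt_pos.2 hμ) hpq
  have hD : ∀ x, 0 < (1 - μ) * ‖x - p‖ ^ 2 + μ * ‖x - q‖ ^ 2 := fun x => by
    rw [← heightDist_geodesicPoint p q x h0.le h1.le]
    exact heightDist_pos hh x
  let z : ℝ → ℝ := fun t => (μ * ‖γ t - q‖ ^ 2 - (1 - μ) * ‖γ t - p‖ ^ 2) /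
    ((1 - μ) * ‖γ t - p‖ ^ 2 + μ * ‖γ t - q‖ ^ 2)
  let z' : ℝ → ℝ := fun t => 4 * (μ * (1 - μ)) *
    ⟪‖γ t - p‖ ^ 2 • (γ t - q) - ‖γ t - q‖ ^ 2 • (γ t - p), deriv γ t⟫ /
      ((1 - μ) * ‖γ t - p‖ ^ 2 + μ * ‖γ t - q‖ ^ 2) ^ 2
  have hz : ∀ t, HasDerivAt z (z' t) t := fun t => by
    have hd : HasDerivAt γ (deriv γ t) t := (hγ.differentiable one_ne_zero t).hasDerivAt
    have hP := (hd.sub_const p).norm_sq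
    have hQ := (hd.sub_const q).norm_sq
    have := ((hQ.const_mul μ).sub (hP.const_mul (1 - μ))).div
      ((hP.const_mul (1 - μ)).add (hQ.const_mul μ)) (hD (γ t)).ne'
    refine this.congr_deriv ?_
    simp only [z', inner_sub_left, inner_smul_left, conj_trivial, Pi.add_apply, Pi.sub_apply]
    congr 1
    ring
  have hz1 : ∀ t, 1 - z t ^ 2 = (2 * √(μ * (1 - μ)) * (‖γ t - p‖ * ‖γ t - q‖) /
      ((1 - μ) * ‖γ t - p‖ ^ 2 + μ * ‖γ t - q‖ ^ 2)) ^ 2 := fun t => by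
    have := (hD (γ t)).ne'
    simp only [z, div_pow, mul_pow, Real.sq_sqrt hμ.le]
    field_simp
    ring
  have hzabs : ∀ t, |z t| ≤ 1 := fun t => by
    rw [← sq_le_one_iff_abs_le_one]
    nlinarith [hz1 t, sq_nonneg (2 * √(μ * (1 - μ)) * (‖γ t - p‖ * ‖γ t - q‖) /
      ((1 - μ) * ‖γ t - p‖ ^ 2 + μ * ‖γ t - q‖ ^ 2))]
  have hrz : ∀ t, 0 < 1 - (r * z t) ^ 2 := fun t => by
    have h2 := (sq_le_one_iff_abs_le_one _).2 (hzabs t)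
    have h3 : r ^ 2 < 1 := by nlinarith
    nlinarith [sq_nonneg (z t), sq_nonneg r]
  have hz'le : ∀ t, |z' t| ≤ √(1 - z t ^ 2) *
      (‖deriv γ t‖ * visDensity (geodesicPoint p q μ) (γ t)) := fun t => by
    have hDt := hD (γ t)
    rw [hz1 t, Real.sqrt_sq (by positivity), visDensity,
      heightDist_geodesicPoint p q (γ t) h0.le h1.le]
    simp only [z', abs_div, abs_mul, abs_of_pos hμ, geodesicPoint]
    rw [abs_of_pos (pow_pos hDt 2), abs_of_pos (by norm_num : (0 : ℝ) < 4)]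
    have h2 := abs_real_inner_le_norm
      (‖γ t - p‖ ^ 2 • (γ t - q) - ‖γ t - q‖ ^ 2 • (γ t - p)) (deriv γ t)
    rw [norm_sq_smul_sub_norm_sq_smul, sub_sub_sub_cancel_left] at h2
    calc _ ≤ 4 * (μ * (1 - μ)) * (‖γ t - p‖ * ‖γ t - q‖ * ‖q - p‖ * ‖deriv γ t‖) /
          ((1 - μ) * ‖γ t - p‖ ^ 2 + μ * ‖γ t - q‖ ^ 2) ^ 2 := by gcongr
      _ = _ := by
        nth_rewrite 1 [← Real.sq_sqrt hμ.le]
        field_simp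
        ring
  have hω : ∀ t, 0 ≤ ‖deriv γ t‖ * visDensity (geodesicPoint p q μ) (γ t) := fun t =>
    mul_nonneg (norm_nonneg _) (div_nonneg (by linarith) (heightDist_nonneg _ _))
  have hφ : ∀ t, HasDerivAt (fun t => arcsin (r * z t))
      (1 / √(1 - (r * z t) ^ 2) * (r * z' t)) t := fun t => by
    have h2 := (sq_lt_one_iff_abs_lt_one (r * z t)).1 (by linarith [hrz t])
    exact (Real.hasDerivAt_arcsin (by linarith [(abs_lt.1 h2).1]) (abs_lt.1 h2).2.ne).comp t
      ((hz t).const_mul r)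
  have hφle : ∀ t, |1 / √(1 - (r * z t) ^ 2) * (r * z' t)| ≤
      ‖deriv γ t‖ * visDensity (geodesicPoint p q μ) (γ t) := fun t => by
    have hs := Real.sqrt_pos.2 (hrz t)
    rw [abs_mul, abs_mul, abs_of_pos hr0, abs_of_pos (by positivity), one_div_mul_eq_div,
      div_le_iff₀ hs]
    have h2 : r * √(1 - z t ^ 2) ≤ √(1 - (r * z t) ^ 2) := by
      rw [← Real.sqrt_sq hr0.le, ← Real.sqrt_mul (sq_nonneg r), Real.sqrt_sq hr0.le]
      apply Real.sqrt_le_sqrt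
      nlinarith
    calc r * |z' t| ≤ r * (√(1 - z t ^ 2) *
          (‖deriv γ t‖ * visDensity (geodesicPoint p q μ) (γ t))) := by gcongr; exact hz'le t
      _ = (r * √(1 - z t ^ 2)) * (‖deriv γ t‖ * visDensity (geodesicPoint p q μ) (γ t)) := by ring
      _ ≤ √(1 - (r * z t) ^ 2) * (‖deriv γ t‖ * visDensity (geodesicPoint p q μ) (γ t)) := by
        gcongr
        exact hω t
      _ = _ := by ring
  have hgc : Continuous fun t => ‖deriv γ t‖ * visDensity (geodesicPoint p q μ) (γ t) :=
    continuous_section_of_continuousOn_prod (continuousOn_visLength_integrand hγ)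
      (mem_visDomain_of_pos hh)
  refine le_trans ?_ (sub_le_integral_of_abs_deriv_le hgc hφ hφle hab)
  have zp : ∀ t, γ t = p → z t = 1 := fun t ht => by
    simp only [z, ht, sub_self]
    rw [← norm_sub_rev q p]
    field_simp
    simp
  have zq : ∀ t, γ t = q → z t = -1 := fun t ht => by
    have : 1 - μ ≠ 0 := (sub_pos.2 h1).ne'
    simp only [z, ht, sub_self]
    field_simp
    simp
  have hpos : 0 ≤ arcsin r := Real.arcsin_nonneg.2 hr0.le
  rcases hends with ⟨ha, hb⟩ | ⟨ha, hb⟩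
  · simp only [zp a ha, zq b hb, mul_neg, mul_one, Real.arcsin_neg]
    rw [abs_sub_comm, abs_of_nonneg (by linarith)]
    linarith
  · simp only [zq a ha, zp b hb, mul_neg, mul_one, Real.arcsin_neg]
    rw [abs_of_nonneg (by linarith)]
    linarith

/-- A closed curve has visual length at least `2π` from any point of a geodesic with endpoints
on the curve. -/
theorem two_pi_le_visLength_geodesicPoint (hγ : ContDiff ℝ 1 γ)
    (hper : Function.Periodic γ (2 * π)) {s₀ s₁ : ℝ} (hne : γ s₀ ≠ γ s₁)
    {μ : ℝ} (h0 : 0 < μ) (h1 : μ < 1) :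
    2 * π ≤ visLength γ (geodesicPoint (γ s₀) (γ s₁) μ) := by
  set a := geodesicPoint (γ s₀) (γ s₁) μ with ha
  have hh : 0 < a.2 := mul_pos (Real.sqrt_pos.2 (mul_pos h0 (sub_pos.2 h1)))
    (norm_sub_pos_iff.2 hne.symm)
  obtain ⟨s, hs, hse⟩ := hper.exists_mem_Ico Real.two_pi_pos s₁ s₀
  have hgc : Continuous fun t => ‖deriv γ t‖ * visDensity a (γ t) :=
    continuous_section_of_continuousOn_prod (continuousOn_visLength_integrand hγ)
      (mem_visDomain_of_pos hh)
  have hdper : Function.Periodic (deriv γ) (2 * π) := fun t => by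
    rw [← deriv_comp_add_const, funext hper]
  have hgper : Function.Periodic (fun t => ‖deriv γ t‖ * visDensity a (γ t)) (2 * π) := fun t => by
    simp only [hdper t, hper t]
  have hsplit : visLength γ a = (∫ t in s₀..s, ‖deriv γ t‖ * visDensity a (γ t)) +
      ∫ t in s..s₀ + 2 * π, ‖deriv γ t‖ * visDensity a (γ t) := by
    rw [intervalIntegral.integral_add_adjacent_intervals (hgc.intervalIntegrable _ _)
      (hgc.intervalIntegrable _ _), hgper.intervalIntegral_add_eq s₀ 0, zero_add]
    rfl
  have hle : ∀ r ∈ Ioo (0 : ℝ) 1, 4 * arcsin r ≤ visLength γ a := fun r hr => by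
    have e1 := two_mul_arcsin_le_integral hγ hne h0 h1 hs.1 hr.1 hr.2 (.inl ⟨rfl, hse.symm⟩)
    have e2 := two_mul_arcsin_le_integral hγ hne h0 h1 hs.2.le hr.1 hr.2
      (.inr ⟨hse.symm, hper s₀⟩)
    rw [hsplit]
    linarith
  have hlim : Tendsto (fun r => 4 * arcsin r) (𝓝[<] 1) (𝓝 (4 * arcsin 1)) :=
    ((Real.continuous_arcsin.const_mul 4).tendsto 1).mono_left nhdsWithin_le_nhds
  have := le_of_tendsto hlim (eventually_of_mem (Ioo_mem_nhdsLT zero_lt_one) hle)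
  rw [Real.arcsin_one] at this
  linarith

end Antipodal

section Flow

open scoped RealInnerProductSpace

theorem visLength_le {V : Type*} [NormedAddCommGroup V] [InnerProductSpace ℝ V] {γ : ℝ → V}
    (hγ : ContDiff ℝ 1 γ) {a : V × ℝ} (ha : 0 < a.2) {m : ℝ} (hm : 0 < m)
    (h : ∀ t, m ≤ heightDist a (γ t)) :
    visLength γ a ≤ (∫ t in (0 : ℝ)..2 * π, ‖deriv γ t‖) * (2 * a.2 / m) := by
  rw [← intervalIntegral.integral_mul_const]
  refine intervalIntegral.integral_mono_on (by positivity)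
    ((continuous_section_of_continuousOn_prod (continuousOn_visLength_integrand hγ)
      (mem_visDomain_of_pos ha)).intervalIntegrable _ _)
    (((hγ.continuous_deriv le_rfl).norm.mul continuous_const).intervalIntegrable _ _)
    fun t _ => ?_
  have := h t
  unfold visDensity
  gcongr

theorem Function.Periodic.exists_pos_le_norm_sub {V : Type*} [NormedAddCommGroup V]
    {γ₁ γ₂ : ℝ → V} {T : ℝ} (hT : 0 < T) (hc₁ : Continuous γ₁) (hc₂ : Continuous γ₂)
    (hper₁ : Function.Periodic γ₁ T) (hper₂ : Function.Periodic γ₂ T)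
    (hdisj : ∀ s t, γ₁ s ≠ γ₂ t) : ∃ d > 0, ∀ s t, d ≤ ‖γ₁ s - γ₂ t‖ := by
  have hK : IsCompact (Icc (0 : ℝ) T ×ˢ Icc (0 : ℝ) T) := isCompact_Icc.prod isCompact_Icc
  obtain ⟨p, -, hp⟩ := hK.exists_isMinOn
    ⟨(0, 0), ⟨le_rfl, hT.le⟩, ⟨le_rfl, hT.le⟩⟩
    (f := fun p : ℝ × ℝ => ‖γ₁ p.1 - γ₂ p.2‖) (by fun_prop)
  refine ⟨_, norm_sub_pos_iff.2 (hdisj p.1 p.2), fun s t => ?_⟩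
  obtain ⟨s', hs', es⟩ := hper₁.exists_mem_Ico₀ hT s
  obtain ⟨t', ht', et⟩ := hper₂.exists_mem_Ico₀ hT t
  rw [es, et]
  exact isMinOn_iff.1 hp (s', t') ⟨Ico_subset_Icc_self hs', Ico_subset_Icc_self ht'⟩

theorem Function.Periodic.exists_norm_le {V : Type*} [NormedAddCommGroup V] {γ : ℝ → V} {T : ℝ}
    (hT : 0 < T) (hc : Continuous γ) (hper : Function.Periodic γ T) : ∃ R, ∀ s, ‖γ s‖ ≤ R := by
  obtain ⟨R, hR⟩ := isCompact_Icc.exists_bound_of_continuousOn hc.continuousOn (s := Icc (0 : ℝ) T)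
  refine ⟨R, fun s => ?_⟩
  obtain ⟨s', hs', es⟩ := hper.exists_mem_Ico₀ hT s
  rw [es]
  exact hR _ (Ico_subset_Icc_self hs')

variable {V : Type*} [NormedAddCommGroup V] [InnerProductSpace ℝ V] {γ₁ γ₂ : ℝ → V} {ℓ : ℝ}

/-- The points of the upper half-space from which both curves have visual length at least `ℓ`. -/
def visCore (γ₁ γ₂ : ℝ → V) (ℓ : ℝ) : Set (V × ℝ) :=
  {a | 0 < a.2 ∧ ℓ ≤ visLength γ₁ a ∧ ℓ ≤ visLength γ₂ a}

theorem isCompact_visCore [FiniteDimensional ℝ V] (h₁ : ContDiff ℝ 1 γ₁) (h₂ : ContDiff ℝ 1 γ₂)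
    (hper₁ : Function.Periodic γ₁ (2 * π)) (hper₂ : Function.Periodic γ₂ (2 * π))
    (hdisj : ∀ s t, γ₁ s ≠ γ₂ t) (hℓ : 0 < ℓ) : IsCompact (visCore γ₁ γ₂ ℓ) := by
  obtain ⟨d, hd, hdle⟩ := Function.Periodic.exists_pos_le_norm_sub Real.two_pi_pos h₁.continuous
    h₂.continuous hper₁ hper₂ hdisj
  obtain ⟨R, hR⟩ := hper₁.exists_norm_le Real.two_pi_pos h₁.continuous
  set Λ₁ := ∫ t in (0 : ℝ)..2 * π, ‖deriv γ₁ t‖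
  set Λ₂ := ∫ t in (0 : ℝ)..2 * π, ‖deriv γ₂ t‖
  have hΛ₁ : 0 ≤ Λ₁ := intervalIntegral.integral_nonneg (by positivity) fun _ _ => norm_nonneg _
  have hΛ₂ : 0 ≤ Λ₂ := intervalIntegral.integral_nonneg (by positivity) fun _ _ => norm_nonneg _
  set Λ := Λ₁ + Λ₂ + 1
  have hΛ : 0 < Λ := by positivity
  have hle : ∀ a ∈ visCore γ₁ γ₂ ℓ, ∀ m > 0, ((∀ t, m ≤ heightDist a (γ₁ t)) ∨
      (∀ t, m ≤ heightDist a (γ₂ t))) → ℓ * m ≤ Λ * (2 * a.2) := by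
    rintro a ⟨ha, hL₁, hL₂⟩ m hm h
    have hq : 0 < 2 * a.2 / m := by positivity
    rw [← le_div_iff₀ hm, mul_div_assoc]
    rcases h with h | h
    · refine (hL₁.trans (visLength_le h₁ ha hm h)).trans ?_
      gcongr
      linarith
    · refine (hL₂.trans (visLength_le h₂ ha hm h)).trans ?_
      gcongr
      linarith
  have hup : ∀ a ∈ visCore γ₁ γ₂ ℓ, a.2 ≤ 2 * Λ / ℓ := fun a ha => by
    have := hle a ha (a.2 ^ 2) (pow_pos ha.1 2) (.inl fun t => by
      unfold heightDist
      nlinarith [sq_nonneg ‖γ₁ t - a.1‖])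
    rw [le_div_iff₀ hℓ]
    refine le_of_mul_le_mul_right ?_ ha.1
    linarith
  have hlow : ∀ a ∈ visCore γ₁ γ₂ ℓ, ℓ * (d / 2) ^ 2 / (2 * Λ) ≤ a.2 := fun a ha => by
    rw [div_le_iff₀ (by positivity)]
    have := hle a ha ((d / 2) ^ 2) (by positivity) (by
      by_cases hc : ∀ t, d / 2 ≤ ‖γ₁ t - a.1‖
      · refine .inl fun t => ?_
        have := pow_le_pow_left₀ (by positivity) (hc t) 2
        unfold heightDist
        nlinarith [sq_nonneg a.2]
      · push Not at hc
        obtain ⟨s, hs⟩ := hc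
        refine .inr fun t => ?_
        have h2 : d / 2 ≤ ‖γ₂ t - a.1‖ := by
          have := (hdle s t).trans (norm_sub_le_norm_sub_add_norm_sub (γ₁ s) a.1 (γ₂ t))
          rw [norm_sub_rev a.1] at this
          linarith
        have := pow_le_pow_left₀ (by positivity) h2 2
        unfold heightDist
        nlinarith [sq_nonneg a.2])
    linarith
  set H := 2 * Λ / ℓ
  have hH : 0 < H := by positivity
  set ρ := 2 * Λ * H / ℓ + 1
  have hρ : 1 ≤ ρ := by
    have : 0 ≤ 2 * Λ * H / ℓ := by positivity
    linarith
  have hball : ∀ a ∈ visCore γ₁ γ₂ ℓ, ‖a.1‖ ≤ R + ρ := fun a ha => by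
    by_contra! hc
    have := hle a ha (ρ ^ 2) (by positivity) (.inl fun t => by
      have h2 : ρ ≤ ‖γ₁ t - a.1‖ := by
        have := norm_sub_norm_le a.1 (γ₁ t)
        rw [norm_sub_rev] at this
        linarith [hR t]
      have := pow_le_pow_left₀ (by positivity) h2 2
      unfold heightDist
      nlinarith [sq_nonneg a.2])
    have h3 : Λ * (2 * a.2) ≤ 2 * Λ * H := by nlinarith [hup a ha]
    have h4 : ℓ * ρ = 2 * Λ * H + ℓ := by
      simp only [ρ]
      field_simp
    nlinarith [mul_le_mul_of_nonneg_left hρ (mul_pos hℓ (zero_lt_one.trans_le hρ)).le]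
  set h₀ := ℓ * (d / 2) ^ 2 / (2 * Λ)
  have hh₀ : 0 < h₀ := by positivity
  have hK : IsCompact (Metric.closedBall (0 : V) (R + ρ) ×ˢ Icc h₀ H) :=
    (isCompact_closedBall _ _).prod isCompact_Icc
  have hpos : ∀ a ∈ Metric.closedBall (0 : V) (R + ρ) ×ˢ Icc h₀ H, 0 < a.2 := fun a ha =>
    hh₀.trans_le ha.2.1
  have hcl : ∀ γ : ℝ → V, ContDiff ℝ 1 γ →
      IsClosed ((Metric.closedBall (0 : V) (R + ρ) ×ˢ Icc h₀ H) ∩ visLength γ ⁻¹' Ici ℓ) :=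
    fun γ hγ => ((continuousOn_visLength hγ).mono fun a ha => mem_visDomain_of_pos
      (hpos a ha)).preimage_isClosed_of_isClosed hK.isClosed isClosed_Ici
  refine hK.of_isClosed_subset ?_ fun a ha =>
    ⟨mem_closedBall_zero_iff.2 (hball a ha), hlow a ha, hup a ha⟩
  convert (hcl γ₁ h₁).inter (hcl γ₂ h₂) using 1
  ext a
  constructor
  · intro ha
    have hmem : a ∈ Metric.closedBall (0 : V) (R + ρ) ×ˢ Icc h₀ H :=
      ⟨mem_closedBall_zero_iff.2 (hball a ha), hlow a ha, hup a ha⟩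
    exact ⟨⟨hmem, ha.2.1⟩, ⟨hmem, ha.2.2⟩⟩
  · rintro ⟨⟨hmem, ha₁⟩, ⟨-, ha₂⟩⟩
    exact ⟨hpos a hmem, ha₁, ha₂⟩

theorem pairing_visGrad_neg [CompleteSpace V] (h₁ : ContDiff ℝ 1 γ₁) (h₂ : ContDiff ℝ 1 γ₂)
    (hdisj : ∀ s t, γ₁ s ≠ γ₂ t) (hℓ : 0 < ℓ) (hE : 2 * mobiusEnergy γ₁ γ₂ < ℓ ^ 2)
    {a : V × ℝ} (ha : a ∈ visCore γ₁ γ₂ ℓ) : pairing (visGrad γ₂ a) (visGrad γ₁ a) < 0 := by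
  obtain ⟨hpos, hL₁, hL₂⟩ := ha
  have h := visLength_mul_add_pairing_le h₁ h₂ hdisj hpos
  have hmul : ℓ ^ 2 ≤ visLength γ₁ a * visLength γ₂ a := by
    rw [sq]
    exact mul_le_mul hL₁ hL₂ hℓ.le (hℓ.le.trans hL₁)
  rw [pairing_comm]
  by_contra! hc
  have := mul_nonneg (sq_nonneg a.2) hc
  linarith

theorem pairing_self_pos {g k : V × ℝ} (h : pairing k g < 0) : 0 < pairing g g := by
  have hg : g ≠ 0 := by
    rintro rfl
    simp at h
  rw [pairing_apply, real_inner_self_eq_norm_sq, ← sq]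
  by_contra! hc
  have e1 : ‖g.1‖ ^ 2 = 0 := by nlinarith [sq_nonneg ‖g.1‖, sq_nonneg g.2]
  have e2 : g.2 ^ 2 = 0 := by nlinarith [sq_nonneg ‖g.1‖, sq_nonneg g.2]
  exact hg (Prod.ext (by simpa using e1) (by simpa using e2))

theorem continuousAt_visGrad {γ : ℝ → V} (hγ : ContDiff ℝ 1 γ) {a : V × ℝ} (ha : 0 < a.2) :
    ContinuousAt (visGrad γ) a :=
  (continuousOn_visGrad hγ).continuousAt (mem_of_superset
    ((isOpen_lt continuous_const continuous_snd).mem_nhds ha) fun _ hb => mem_visDomain_of_pos hb)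

theorem hasDerivAt_visLength_line [CompleteSpace V] {γ : ℝ → V} (hγ : ContDiff ℝ 1 γ)
    {a g : V × ℝ} {τ : ℝ} (h : 0 < (a + τ • g).2) :
    HasDerivAt (fun τ => visLength γ (a + τ • g)) (pairing (visGrad γ (a + τ • g)) g) τ := by
  have hl : HasDerivAt (fun τ : ℝ => a + τ • g) g τ := by
    simpa using ((hasDerivAt_id τ).smul_const g).const_add a
  exact (hasFDerivAt_visLength hγ h).comp_hasDerivAt τ hl

/-- Uniform control of short steps along the gradient of the first visual length. -/
theorem exists_uniform_step [FiniteDimensional ℝ V] (h₁ : ContDiff ℝ 1 γ₁) (h₂ : ContDiff ℝ 1 γ₂)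
    (hper₁ : Function.Periodic γ₁ (2 * π)) (hper₂ : Function.Periodic γ₂ (2 * π))
    (hdisj : ∀ s t, γ₁ s ≠ γ₂ t) (hℓ : 0 < ℓ) (hE : 2 * mobiusEnergy γ₁ γ₂ < ℓ ^ 2) (Λ : ℝ) :
    ∃ ε > 0, ∃ η > 0, ∀ a ∈ visCore γ₁ γ₂ ℓ, ∀ τ ∈ Icc 0 ε,
      τ * (Λ * (4 / a.2 ^ 3)) ≤ 1 ∧ 0 < (a + τ • visGrad γ₁ a).2 ∧
      visLength γ₁ a ≤ visLength γ₁ (a + τ • visGrad γ₁ a) ∧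
      visLength γ₂ (a + τ • visGrad γ₁ a) ≤ visLength γ₂ a - η * τ := by
  have hcpt := isCompact_visCore h₁ h₂ hper₁ hper₂ hdisj hℓ
  have hdom : visCore γ₁ γ₂ ℓ ⊆ {a | 0 < a.2} := fun a ha => ha.1
  have hneg := fun a (ha : a ∈ visCore γ₁ γ₂ ℓ) => pairing_visGrad_neg h₁ h₂ hdisj hℓ hE ha
  obtain ⟨η, hη, hηle⟩ : ∃ η > 0, ∀ a ∈ visCore γ₁ γ₂ ℓ,
      pairing (visGrad γ₂ a) (visGrad γ₁ a) < -η := by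
    rcases (visCore γ₁ γ₂ ℓ).eq_empty_or_nonempty with h0 | h0
    · exact ⟨1, one_pos, by simp [h0]⟩
    obtain ⟨b, hb, hmax⟩ := hcpt.exists_isMaxOn h0
      (f := fun a => pairing (visGrad γ₂ a) (visGrad γ₁ a)) fun a ha =>
        ((continuous_pairing.continuousAt.comp (continuousAt_visGrad h₂ ha.1)).clm_apply
          (continuousAt_visGrad h₁ ha.1)).continuousWithinAt
    refine ⟨-pairing (visGrad γ₂ b) (visGrad γ₁ b) / 2, by linarith [hneg b hb], fun a ha => ?_⟩
    have := hmax ha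
    simp only [mem_ofPred_eq] at this
    linarith [hneg b hb]
  have hev := hcpt.eventually_forall_of_forall_eventually (x₀ := (0 : ℝ))
    (P := fun τ a => τ * (Λ * (4 / a.2 ^ 3)) < 1 ∧ 0 < (a + τ • visGrad γ₁ a).2 ∧
      0 < pairing (visGrad γ₁ (a + τ • visGrad γ₁ a)) (visGrad γ₁ a) ∧
      pairing (visGrad γ₂ (a + τ • visGrad γ₁ a)) (visGrad γ₁ a) < -η) fun a ha => by
    have hg : ContinuousAt (fun p : ℝ × (V × ℝ) => visGrad γ₁ p.2) (0, a) :=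
      ContinuousAt.comp (g := visGrad γ₁) (f := Prod.snd) (x := ((0 : ℝ), a))
        (continuousAt_visGrad h₁ ha.1) continuousAt_snd
    have hm : ContinuousAt (fun p : ℝ × (V × ℝ) => p.2 + p.1 • visGrad γ₁ p.2) (0, a) :=
      continuousAt_snd.add (continuousAt_fst.smul hg)
    have hm0 : a + (0 : ℝ) • visGrad γ₁ a = a := by simp
    have hG : ∀ {γ : ℝ → V}, ContDiff ℝ 1 γ → ContinuousAt (fun p : ℝ × (V × ℝ) =>
        pairing (visGrad γ (p.2 + p.1 • visGrad γ₁ p.2)) (visGrad γ₁ p.2)) (0, a) :=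
    fun {γ} hγ => by
      refine ContinuousAt.clm_apply (continuous_pairing.continuousAt.comp ?_) hg
      exact ContinuousAt.comp (g := visGrad γ) (f := fun p : ℝ × (V × ℝ) =>
        p.2 + p.1 • visGrad γ₁ p.2) (by
          simp only [hm0]
          exact continuousAt_visGrad hγ ha.1) hm
    have c1 : ContinuousAt (fun p : ℝ × (V × ℝ) => p.1 * (Λ * (4 / p.2.2 ^ 3))) (0, a) :=
      continuousAt_fst.mul (continuousAt_const.mul (continuousAt_const.div (by fun_prop)
        (pow_pos ha.1 3).ne'))
    refine (c1.eventually_lt continuousAt_const (by simp)).and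
      ((continuousAt_const.eventually_lt (continuous_snd.continuousAt.comp hm) ?_).and
        ((continuousAt_const.eventually_lt (hG h₁) ?_).and
          ((hG h₂).eventually_lt continuousAt_const ?_)))
    · simpa using ha.1
    · simp only [hm0]
      exact pairing_self_pos (hneg a ha)
    · simp only [hm0]
      exact hηle a ha
  obtain ⟨ε, hε, hball⟩ := Metric.eventually_nhds_iff_ball.1 hev
  refine ⟨ε / 2, by positivity, η, hη, fun a ha τ hτ => ?_⟩
  have hP : ∀ t ∈ Icc 0 τ, _ := fun t ht => hball t (by
    rw [mem_ball_zero_iff, Real.norm_eq_abs, abs_of_nonneg ht.1]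
    linarith [ht.2, hτ.2]) a ha
  have hτm : τ ∈ Icc 0 τ := ⟨hτ.1, le_rfl⟩
  have hd : ∀ {γ : ℝ → V}, ContDiff ℝ 1 γ → ∀ t ∈ Icc 0 τ, HasDerivAt
      (fun τ => visLength γ (a + τ • visGrad γ₁ a))
      (pairing (visGrad γ (a + t • visGrad γ₁ a)) (visGrad γ₁ a)) t := fun hγ t ht =>
    hasDerivAt_visLength_line hγ (hP t ht).2.1
  refine ⟨(hP τ hτm).1.le, (hP τ hτm).2.1, ?_, ?_⟩
  · have := (convex_Icc 0 τ).mul_sub_le_image_sub_of_le_deriv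
      (fun t ht => (hd h₁ t ht).continuousAt.continuousWithinAt)
      (fun t ht => (hd h₁ t (interior_subset ht)).differentiableAt.differentiableWithinAt)
      (C := 0) (fun t ht => by
        rw [(hd h₁ t (interior_subset ht)).deriv]
        exact (hP t (interior_subset ht)).2.2.1.le) 0 ⟨le_rfl, hτ.1⟩ τ hτm hτ.1
    simp only [zero_smul, add_zero] at this
    linarith
  · have := (convex_Icc 0 τ).image_sub_le_mul_sub_of_deriv_le
      (fun t ht => (hd h₂ t ht).continuousAt.continuousWithinAt)
      (fun t ht => (hd h₂ t (interior_subset ht)).differentiableAt.differentiableWithinAt)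
      (C := -η) (fun t ht => by
        rw [(hd h₂ t (interior_subset ht)).deriv]
        exact (hP t (interior_subset ht)).2.2.2.le) 0 ⟨le_rfl, hτ.1⟩ τ hτm hτ.1
    simp only [zero_smul, add_zero] at this
    linarith

theorem inner_visGrad_le [CompleteSpace V] {γ : ℝ → V} (hγ : ContDiff ℝ 1 γ) {a : V × ℝ}
    (ha : 0 < a.2) {z : V} {M : ℝ} (hM : ∀ s, ⟪γ s, z⟫ ≤ M) (haM : ⟪a.1, z⟫ ≤ M) :
    ⟪(visGrad γ a).1, z⟫ ≤
      (∫ t in (0 : ℝ)..2 * π, ‖deriv γ t‖) * (4 / a.2 ^ 3) * (M - ⟪a.1, z⟫) := by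
  have h := pairing_visGrad hγ (mem_visDomain_of_pos (γ := γ) ha) (z, 0)
  rw [pairing_apply, mul_zero, add_zero] at h
  rw [h, mul_assoc, ← intervalIntegral.integral_mul_const]
  have hc : Continuous fun t => ‖deriv γ t‖ * pairing (visDensityGrad a (γ t)) (z, 0) :=
    (hγ.continuous_deriv le_rfl).norm.mul ((continuous_pairing.comp
      ((continuousOn_visDensityGrad hγ.continuous).comp_continuous (f := fun t => (a, t))
        (by fun_prop) fun t => (heightDist_pos ha _).ne')).clm_apply continuous_const)
  refine intervalIntegral.integral_mono_on (by positivity) (hc.intervalIntegrable _ _)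
    (((hγ.continuous_deriv le_rfl).norm.mul continuous_const).intervalIntegrable _ _)
    fun t _ => ?_
  refine mul_le_mul_of_nonneg_left ?_ (norm_nonneg _)
  have hD := heightDist_pos ha (γ t)
  have hD2 : a.2 ^ 2 ≤ heightDist a (γ t) := by
    unfold heightDist
    nlinarith [sq_nonneg ‖γ t - a.1‖]
  have hw : 4 * a.2 / heightDist a (γ t) ^ 2 ≤ 4 / a.2 ^ 3 := by
    calc _ ≤ 4 * a.2 / (a.2 ^ 2) ^ 2 := by gcongr
      _ = _ := by field_simp
  simp only [pairing_apply, visDensityGrad, inner_smul_left, conj_trivial, mul_zero, add_zero,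
    inner_sub_left]
  calc _ ≤ 4 * a.2 / heightDist a (γ t) ^ 2 * (M - ⟪a.1, z⟫) := by
        gcongr
        exact hM t
    _ ≤ _ := by gcongr

end Flow

section Disc

open scoped RealInnerProductSpace

variable {V : Type*} [NormedAddCommGroup V] [InnerProductSpace ℝ V] {γ₁ γ₂ : ℝ → V} {ℓ : ℝ}

/-- A step along the gradient of the visual length of `γ₁`, taken only where the visual length of
`γ₂` exceeds `ℓ`. -/
def flowStep (γ₁ γ₂ : ℝ → V) (ℓ κ : ℝ) (a : V × ℝ) : V × ℝ :=
  a + (κ * max 0 (visLength γ₂ a - ℓ)) • visGrad γ₁ a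

theorem flowStep_eq_self {κ : ℝ} {a : V × ℝ} (h : visLength γ₂ a ≤ ℓ) :
    flowStep γ₁ γ₂ ℓ κ a = a := by
  simp [flowStep, max_eq_left (sub_nonpos.2 h)]

theorem visLength_eq_zero {γ : ℝ → V} {a : V × ℝ} (h : a.2 = 0) : visLength γ a = 0 := by
  simp [visLength, visDensity, h]

theorem continuousAt_flowStep (h₁ : ContDiff ℝ 1 γ₁) (h₂ : ContDiff ℝ 1 γ₂) (κ : ℝ) {a : V × ℝ}
    (ha : 0 < a.2) : ContinuousAt (flowStep γ₁ γ₂ ℓ κ) a := by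
  have hL : ContinuousAt (visLength γ₂) a :=
    (continuousOn_visLength h₂).continuousAt (mem_of_superset
      ((isOpen_lt continuous_const continuous_snd).mem_nhds ha) fun _ hb =>
        mem_visDomain_of_pos hb)
  exact continuousAt_id.add ((continuousAt_const.mul (continuousAt_const.max
    (hL.sub continuousAt_const))).smul (continuousAt_visGrad h₁ ha))

theorem exists_flowStep [FiniteDimensional ℝ V] (h₁ : ContDiff ℝ 1 γ₁) (h₂ : ContDiff ℝ 1 γ₂)
    (hper₁ : Function.Periodic γ₁ (2 * π)) (hper₂ : Function.Periodic γ₂ (2 * π))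
    (hdisj : ∀ s t, γ₁ s ≠ γ₂ t) (hℓ : 0 < ℓ) (hE : 2 * mobiusEnergy γ₁ γ₂ < ℓ ^ 2)
    {z : V} {M : ℝ} (hM : ∀ s, ⟪γ₁ s, z⟫ ≤ M) :
    ∃ κ B ρ : ℝ, 0 ≤ B ∧ 0 ≤ ρ ∧ ρ < 1 ∧ ∀ a ∈ visCore γ₁ γ₂ ℓ, visLength γ₂ a - ℓ ≤ B ∧
      0 < (flowStep γ₁ γ₂ ℓ κ a).2 ∧ ℓ ≤ visLength γ₁ (flowStep γ₁ γ₂ ℓ κ a) ∧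
      visLength γ₂ (flowStep γ₁ γ₂ ℓ κ a) - ℓ ≤ ρ * (visLength γ₂ a - ℓ) ∧
      (⟪a.1, z⟫ ≤ M → ⟪(flowStep γ₁ γ₂ ℓ κ a).1, z⟫ ≤ M) := by
  obtain ⟨ε, hε, η, hη, hstep⟩ := exists_uniform_step h₁ h₂ hper₁ hper₂ hdisj hℓ hE
    (∫ t in (0 : ℝ)..2 * π, ‖deriv γ₁ t‖)
  obtain ⟨B, hB⟩ := (isCompact_visCore h₁ h₂ hper₁ hper₂ hdisj hℓ).exists_bound_of_continuousOn
    ((continuousOn_visLength h₂).mono fun a ha => mem_visDomain_of_pos ha.1)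
  set C := |B| + 1
  have hC : 0 < C := by positivity
  have hBC : ∀ a ∈ visCore γ₁ γ₂ ℓ, visLength γ₂ a - ℓ ≤ C := fun a ha => by
    have h1 := (le_abs_self _).trans (hB a ha)
    have h2 := le_abs_self B
    simp only [C]
    linarith
  refine ⟨ε / C, C, max 0 (1 - η * (ε / C)), hC.le, le_max_left _ _, max_lt one_pos ?_,
    fun a ha => ?_⟩
  · have : 0 < η * (ε / C) := by positivity
    linarith
  have hx : 0 ≤ visLength γ₂ a - ℓ := sub_nonneg.2 ha.2.2
  have hdef : flowStep γ₁ γ₂ ℓ (ε / C) a =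
      a + (ε / C * (visLength γ₂ a - ℓ)) • visGrad γ₁ a := by rw [flowStep, max_eq_right hx]
  rw [hdef]
  set τ := ε / C * (visLength γ₂ a - ℓ) with hτdef
  have hτ : τ ∈ Icc 0 ε := by
    refine ⟨by positivity, ?_⟩
    rw [hτdef, div_mul_eq_mul_div, div_le_iff₀ hC]
    gcongr
    exact hBC a ha
  obtain ⟨s1, s2, s3, s4⟩ := hstep a ha τ hτ
  refine ⟨hBC a ha, s2, ha.2.1.trans s3, ?_, fun haM => ?_⟩
  · calc _ ≤ (1 - η * (ε / C)) * (visLength γ₂ a - ℓ) := by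
          rw [hτdef] at s4 ⊢
          linarith
      _ ≤ _ := by
          gcongr
          exact le_max_right _ _
  · have h := inner_visGrad_le h₁ ha.1 hM haM
    have h' := mul_le_mul_of_nonneg_left h hτ.1
    simp only [Prod.fst_add, Prod.smul_fst, inner_add_left, inner_smul_left, conj_trivial]
    nlinarith [mul_le_mul_of_nonneg_right s1 (sub_nonneg.2 haM)]

/-- A disc in the closed upper half-space spanned by the closed curve `γ`, in polar coordinates,
whose interior points see `γ` with visual length at least `ℓ`, and which lies over the half-space
`⟪·, z⟫ ≤ M`. -/
structure IsVisualDisc (γ : ℝ → V) (ℓ : ℝ) (z : V) (M : ℝ) (A : ℝ → ℝ → V × ℝ) : Prop where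
  continuous : Continuous (Function.uncurry A)
  closed : ∀ θ, A 0 θ = A (2 * π) θ
  center : ∀ s, A s 0 = (γ 0, 0)
  boundary : ∀ s, A s (π / 2) = (γ s, 0)
  cases : ∀ s θ, ((A s θ).2 = 0 ∧ ∃ s', (A s θ).1 = γ s') ∨
    (0 < (A s θ).2 ∧ ℓ ≤ visLength γ (A s θ))
  inner_le : ∀ s θ, ⟪(A s θ).1, z⟫ ≤ M

theorem isVisualDisc_cone {γ : ℝ → V} (hγ : ContDiff ℝ 1 γ) (hper : Function.Periodic γ (2 * π))
    (hℓ : ℓ ≤ 2 * π) {z : V} {M : ℝ} (hM : ∀ s, ⟪γ s, z⟫ ≤ M) :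
    IsVisualDisc γ ℓ z M fun s θ => geodesicPoint (γ 0) (γ s) (sin θ ^ 2) where
  continuous := by
    have := hγ.continuous
    change Continuous fun p : ℝ × ℝ => geodesicPoint (γ 0) (γ p.1) (sin p.2 ^ 2)
    unfold geodesicPoint
    fun_prop
  closed θ := by
    have : γ (2 * π) = γ 0 := by simpa using hper 0
    rw [this]
  center s := by simp [geodesicPoint]
  boundary s := by simp [geodesicPoint]
  cases s θ := by
    have hs0 := sq_nonneg (sin θ)
    have hs1 : sin θ ^ 2 ≤ 1 := Real.sin_sq_le_one θ
    by_cases hne : γ 0 = γ s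
    · exact .inl ⟨by simp [geodesicPoint, hne], 0, by simp [geodesicPoint, hne]⟩
    rcases hs0.eq_or_lt with h0 | h0
    · exact .inl ⟨by simp [geodesicPoint, ← h0], 0, by simp [geodesicPoint, ← h0]⟩
    rcases hs1.eq_or_lt with h1 | h1
    · exact .inl ⟨by simp [geodesicPoint, h1], s, by simp [geodesicPoint, h1]⟩
    · exact .inr ⟨mul_pos (Real.sqrt_pos.2 (mul_pos h0 (sub_pos.2 h1)))
        (norm_sub_pos_iff.2 (Ne.symm hne)),
        hℓ.trans (two_pi_le_visLength_geodesicPoint hγ hper hne h0 h1)⟩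
  inner_le s θ := by
    simp only [geodesicPoint, inner_add_left, inner_smul_left, inner_sub_left, conj_trivial]
    nlinarith [mul_le_mul_of_nonneg_left (hM s) (sq_nonneg (sin θ)),
      mul_le_mul_of_nonneg_left (hM 0) (sub_nonneg.2 (Real.sin_sq_le_one θ))]

theorem IsVisualDisc.comp_flowStep (h₁ : ContDiff ℝ 1 γ₁) (h₂ : ContDiff ℝ 1 γ₂)
    (hdisj : ∀ s t, γ₁ s ≠ γ₂ t) (hℓ : 0 < ℓ) {z : V} {M κ : ℝ}
    (hstep : ∀ a ∈ visCore γ₁ γ₂ ℓ, 0 < (flowStep γ₁ γ₂ ℓ κ a).2 ∧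
      ℓ ≤ visLength γ₁ (flowStep γ₁ γ₂ ℓ κ a) ∧
      (⟪a.1, z⟫ ≤ M → ⟪(flowStep γ₁ γ₂ ℓ κ a).1, z⟫ ≤ M))
    {A : ℝ → ℝ → V × ℝ} (hA : IsVisualDisc γ₁ ℓ z M A) :
    IsVisualDisc γ₁ ℓ z M fun s θ => flowStep γ₁ γ₂ ℓ κ (A s θ) := by
  have hzero : ∀ a : V × ℝ, a.2 = 0 → flowStep γ₁ γ₂ ℓ κ a = a := fun a ha =>
    flowStep_eq_self (by rw [visLength_eq_zero ha]; exact hℓ.le)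
  have hdom : ∀ s θ, A s θ ∈ visDomain γ₂ := fun s θ => by
    rcases hA.cases s θ with ⟨h0, s', hs'⟩ | ⟨hpos, -⟩
    · intro t
      simp only [heightDist, h0, hs']
      simpa [sub_eq_zero] using (hdisj s' t).symm
    · exact mem_visDomain_of_pos hpos
  have hL : Continuous fun p : ℝ × ℝ => visLength γ₂ (A p.1 p.2) :=
    (continuousOn_visLength h₂).comp_continuous hA.continuous fun p => hdom p.1 p.2
  refine ⟨?_, fun θ => by rw [hA.closed], fun s => by rw [hA.center, hzero _ rfl],
    fun s => by rw [hA.boundary, hzero _ rfl], fun s θ => ?_, fun s θ => ?_⟩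
  · refine continuous_iff_continuousAt.2 fun p => ?_
    rcases hA.cases p.1 p.2 with ⟨h0, -⟩ | ⟨hpos, -⟩
    · refine hA.continuous.continuousAt.congr ?_
      have hlt : visLength γ₂ (A p.1 p.2) < ℓ := by rwa [visLength_eq_zero h0]
      filter_upwards [hL.continuousAt.eventually_lt continuousAt_const hlt] with q hq
      exact (flowStep_eq_self hq.le).symm
    · exact ContinuousAt.comp (g := flowStep γ₁ γ₂ ℓ κ) (f := Function.uncurry A)
        (continuousAt_flowStep h₁ h₂ κ hpos) hA.continuous.continuousAt
  · rcases hA.cases s θ with h | h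
    · rw [hzero _ h.1]
      exact .inl h
    · rcases le_or_gt (visLength γ₂ (A s θ)) ℓ with hle | hlt
      · rw [flowStep_eq_self hle]
        exact .inr h
      · obtain ⟨e1, e2, -⟩ := hstep _ ⟨h.1, h.2, hlt.le⟩
        exact .inr ⟨e1, e2⟩
  · rcases hA.cases s θ with h | h
    · rw [hzero _ h.1]
      exact hA.inner_le s θ
    · rcases le_or_gt (visLength γ₂ (A s θ)) ℓ with hle | hlt
      · rw [flowStep_eq_self hle]
        exact hA.inner_le s θ
      · exact (hstep _ ⟨h.1, h.2, hlt.le⟩).2.2 (hA.inner_le s θ)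

/-- If the energy is small, then `γ₁` spans a disc from whose points `γ₂` has visual length less
than `2π`. -/
theorem exists_isVisualDisc [FiniteDimensional ℝ V] (h₁ : ContDiff ℝ 1 γ₁) (h₂ : ContDiff ℝ 1 γ₂)
    (hper₁ : Function.Periodic γ₁ (2 * π)) (hper₂ : Function.Periodic γ₂ (2 * π))
    (hdisj : ∀ s t, γ₁ s ≠ γ₂ t) (hE : mobiusEnergy γ₁ γ₂ < 2 * π ^ 2)
    {z : V} {M : ℝ} (hM : ∀ s, ⟪γ₁ s, z⟫ ≤ M) :
    ∃ ℓ A, IsVisualDisc γ₁ ℓ z M A ∧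
      ∀ s θ, 0 < (A s θ).2 → visLength γ₂ (A s θ) < 2 * π := by
  obtain ⟨ℓ, hℓ, hEℓ, hℓπ⟩ : ∃ ℓ : ℝ, 0 < ℓ ∧ 2 * mobiusEnergy γ₁ γ₂ < ℓ ^ 2 ∧ ℓ < 2 * π := by
    have hlim : Tendsto (fun x : ℝ => x ^ 2) (𝓝[<] (2 * π)) (𝓝 ((2 * π) ^ 2)) :=
      ((continuous_pow 2).tendsto _).mono_left nhdsWithin_le_nhds
    have h1 := hlim.eventually_const_lt (by nlinarith : 2 * mobiusEnergy γ₁ γ₂ < (2 * π) ^ 2)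
    have h2 := Ioo_mem_nhdsLT Real.two_pi_pos
    obtain ⟨ℓ, e1, e2⟩ := (h1.and h2).exists
    exact ⟨ℓ, e2.1, e1, e2.2⟩
  obtain ⟨κ, B, ρ, hB, hρ0, hρ1, hstep⟩ := exists_flowStep h₁ h₂ hper₁ hper₂ hdisj hℓ hEℓ hM
  have hiter : ∀ n : ℕ, ∃ A, IsVisualDisc γ₁ ℓ z M A ∧
      ∀ s θ, 0 < (A s θ).2 → visLength γ₂ (A s θ) - ℓ ≤ B * ρ ^ n := by
    intro n
    induction n with
    | zero =>
      have hA := isVisualDisc_cone h₁ hper₁ hℓπ.le hM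
      refine ⟨_, hA, fun s θ hpos => ?_⟩
      rw [pow_zero, mul_one]
      rcases le_or_gt (visLength γ₂ (geodesicPoint (γ₁ 0) (γ₁ s) (sin θ ^ 2))) ℓ with hle | hlt
      · linarith
      · rcases hA.cases s θ with h | h
        · exact absurd h.1 hpos.ne'
        · exact (hstep _ ⟨h.1, h.2, hlt.le⟩).1
    | succ n ih =>
      obtain ⟨A, hA, hAn⟩ := ih
      refine ⟨_, hA.comp_flowStep h₁ h₂ hdisj hℓ fun a ha => ⟨(hstep a ha).2.1, (hstep a ha).2.2.1,
        (hstep a ha).2.2.2.2⟩, fun s θ hpos => ?_⟩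
      have hnn : 0 ≤ B * ρ ^ (n + 1) := by positivity
      rcases le_or_gt (visLength γ₂ (A s θ)) ℓ with hle | hlt
      · rw [flowStep_eq_self hle]
        linarith
      · rcases hA.cases s θ with h | h
        · rw [visLength_eq_zero h.1] at hlt
          exact absurd hlt hℓ.not_gt
        · calc _ ≤ ρ * (visLength γ₂ (A s θ) - ℓ) := (hstep _ ⟨h.1, h.2, hlt.le⟩).2.2.2.1
            _ ≤ ρ * (B * ρ ^ n) := by gcongr; exact hAn s θ h.1
            _ = _ := by ring
  have hlim : Tendsto (fun n : ℕ => B * ρ ^ n) atTop (𝓝 (B * 0)) :=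
    (tendsto_pow_atTop_nhds_zero_of_lt_one hρ0 hρ1).const_mul B
  obtain ⟨n, hn⟩ := (hlim.eventually_lt_const
    (by linarith : B * 0 < 2 * π - ℓ)).exists
  obtain ⟨A, hA, hAn⟩ := hiter n
  exact ⟨ℓ, A, hA, fun s θ hpos => by linarith [hAn s θ hpos]⟩

end Disc

section Linking

theorem gaussLinking_integrand_continuous {γ₁ γ₂ : ℝ → EuclideanSpace ℝ (Fin 3)}
    (h₁ : ContDiff ℝ 1 γ₁) (h₂ : ContDiff ℝ 1 γ₂) (hdisj : ∀ s t, γ₁ s ≠ γ₂ t) :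
    Continuous fun p : ℝ × ℝ =>
      det3 (deriv γ₁ p.1) (deriv γ₂ p.2) (γ₁ p.1 - γ₂ p.2) / ‖γ₁ p.1 - γ₂ p.2‖ ^ 3 := by
  have c₁ := h₁.continuous
  have c₂ := h₂.continuous
  have d₁ := h₁.continuous_deriv le_rfl
  have d₂ := h₂.continuous_deriv le_rfl
  refine Continuous.div ?_ (by fun_prop) fun p =>
    pow_ne_zero _ (norm_ne_zero_iff.2 (sub_ne_zero.2 (hdisj _ _)))
  simp only [det3_apply]
  fun_prop

theorem gaussLinking_comm {γ₁ γ₂ : ℝ → EuclideanSpace ℝ (Fin 3)}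
    (h₁ : ContDiff ℝ 1 γ₁) (h₂ : ContDiff ℝ 1 γ₂) (hdisj : ∀ s t, γ₁ s ≠ γ₂ t) :
    gaussLinking γ₁ γ₂ = gaussLinking γ₂ γ₁ := by
  unfold gaussLinking
  congr 1
  rw [intervalIntegral_intervalIntegral_swap]
  · refine intervalIntegral.integral_congr fun t _ => intervalIntegral.integral_congr fun s _ => ?_
    simp only [norm_sub_rev (γ₂ t) (γ₁ s), det3_apply, PiLp.sub_apply]
    ring
  · exact ((gaussLinking_integrand_continuous h₁ h₂ hdisj).continuousOn.integrableOn_compact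
      (isCompact_uIcc.prod isCompact_uIcc)).mono_set (prod_mono uIoc_subset_uIcc uIoc_subset_uIcc)

theorem mobiusEnergy_comm {E : Type*} [NormedAddCommGroup E] [NormedSpace ℝ E] {γ₁ γ₂ : ℝ → E}
    (h₁ : ContDiff ℝ 1 γ₁) (h₂ : ContDiff ℝ 1 γ₂) (hdisj : ∀ s t, γ₁ s ≠ γ₂ t) :
    mobiusEnergy γ₁ γ₂ = mobiusEnergy γ₂ γ₁ := by
  have c₁ := h₁.continuous
  have c₂ := h₂.continuous
  have d₁ := h₁.continuous_deriv le_rfl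
  have d₂ := h₂.continuous_deriv le_rfl
  unfold mobiusEnergy
  rw [intervalIntegral_intervalIntegral_swap]
  · refine intervalIntegral.integral_congr fun t _ => intervalIntegral.integral_congr fun s _ => ?_
    simp only [norm_sub_rev (γ₂ t) (γ₁ s), mul_comm]
  · have hc : Continuous fun p : ℝ × ℝ =>
        ‖deriv γ₁ p.1‖ * ‖deriv γ₂ p.2‖ / ‖γ₁ p.1 - γ₂ p.2‖ ^ 2 :=
      Continuous.div (by fun_prop) (by fun_prop) fun p =>
        pow_ne_zero _ (norm_ne_zero_iff.2 (sub_ne_zero.2 (hdisj _ _)))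
    exact (hc.continuousOn.integrableOn_compact
      (isCompact_uIcc.prod isCompact_uIcc)).mono_set (prod_mono uIoc_subset_uIcc uIoc_subset_uIcc)

theorem gaussLinking_eq_zero_of_inner_le {γ₁ γ₂ : ℝ → EuclideanSpace ℝ (Fin 3)}
    (h₁ : ContDiff ℝ 1 γ₁) (h₂ : ContDiff ℝ 1 γ₂)
    (hper₁ : Function.Periodic γ₁ (2 * π)) (hper₂ : Function.Periodic γ₂ (2 * π))
    (hdisj : ∀ s t, γ₁ s ≠ γ₂ t) (hE : mobiusEnergy γ₁ γ₂ < 2 * π ^ 2) {t₀ M : ℝ}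
    (hM : ∀ s, inner ℝ (γ₁ s) (γ₂ t₀) ≤ M) (hlt : M < ‖γ₂ t₀‖ ^ 2) :
    gaussLinking γ₁ γ₂ = 0 := by
  obtain ⟨ℓ, A, hA, hlow⟩ := exists_isVisualDisc h₁ h₂ hper₁ hper₂ hdisj hE hM
  have hAc := hA.continuous
  have hne : ∀ s θ, (A s θ).1 - γ₂ t₀ ≠ 0 := fun s θ h => by
    have h' := hA.inner_le s θ
    rw [sub_eq_zero.1 h, real_inner_self_eq_norm_sq] at h'
    linarith
  set Q : ℝ → ℝ → EuclideanSpace ℝ (Fin 3) := fun s θ =>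
    γ₂ t₀ + ((‖(A s θ).1 - γ₂ t₀‖ ^ 2 + (A s θ).2 ^ 2) / ‖(A s θ).1 - γ₂ t₀‖ ^ 2) •
      ((A s θ).1 - γ₂ t₀) with hQdef
  have hQzero : ∀ s θ, (A s θ).2 = 0 → Q s θ = (A s θ).1 := fun s θ h => by
    have := pow_ne_zero 2 (norm_ne_zero_iff.2 (hne s θ))
    simp [hQdef, h, div_self this]
  have hQ : Continuous (Function.uncurry Q) := by
    have hc : Continuous fun p : ℝ × ℝ => (A p.1 p.2).1 - γ₂ t₀ :=
      hAc.fst.sub continuous_const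
    have hh : Continuous fun p : ℝ × ℝ => (A p.1 p.2).2 := hAc.snd
    exact continuous_const.add ((((hc.norm.pow 2).add (hh.pow 2)).div (hc.norm.pow 2) fun p =>
      pow_ne_zero 2 (norm_ne_zero_iff.2 (hne p.1 p.2))).smul hc)
  have hQS : ∀ s θ, Q s θ ∈ (range γ₂)ᶜ := by
    rintro s θ ⟨t, ht⟩
    rcases hA.cases s θ with ⟨h, s', hs'⟩ | ⟨hpos, -⟩
    · exact hdisj s' t (by rw [ht, hQzero s θ h, hs'])
    · have hsub : γ₂ t - γ₂ t₀ = ((‖(A s θ).1 - γ₂ t₀‖ ^ 2 + (A s θ).2 ^ 2) /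
          ‖(A s θ).1 - γ₂ t₀‖ ^ 2) • ((A s θ).1 - γ₂ t₀) := by
        rw [ht, hQdef, add_sub_cancel_left]
      have hd : 0 < ‖(A s θ).1 - γ₂ t₀‖ := norm_pos_iff.2 (hne s θ)
      have hgeo : geodesicPoint (γ₂ t₀) (γ₂ t)
          (‖(A s θ).1 - γ₂ t₀‖ ^ 2 / (‖(A s θ).1 - γ₂ t₀‖ ^ 2 + (A s θ).2 ^ 2)) = A s θ := by
        unfold geodesicPoint
        rw [hsub, smul_smul, norm_smul]
        set d := ‖(A s θ).1 - γ₂ t₀‖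
        set h := (A s θ).2
        have hs : 0 < d ^ 2 + h ^ 2 := by positivity
        refine Prod.ext ?_ ?_
        · have : d ^ 2 / (d ^ 2 + h ^ 2) * ((d ^ 2 + h ^ 2) / d ^ 2) = 1 := by field_simp
          simp only [this, one_smul, add_sub_cancel]
        · have : d ^ 2 / (d ^ 2 + h ^ 2) * (1 - d ^ 2 / (d ^ 2 + h ^ 2)) =
              (d * h / (d ^ 2 + h ^ 2)) ^ 2 := by field_simp; ring
          simp only [this]
          rw [Real.sqrt_sq (by positivity), Real.norm_of_nonneg (by positivity)]
          change _ = h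
          field_simp
      have hs : 0 < ‖(A s θ).1 - γ₂ t₀‖ ^ 2 + (A s θ).2 ^ 2 := by positivity
      have h := two_pi_le_visLength_geodesicPoint h₂ hper₂ (s₀ := t₀) (s₁ := t)
        (μ := ‖(A s θ).1 - γ₂ t₀‖ ^ 2 / (‖(A s θ).1 - γ₂ t₀‖ ^ 2 + (A s θ).2 ^ 2))
        (fun h => smul_ne_zero (div_pos hs (pow_pos hd 2)).ne' (hne s θ)
          (hsub.symm.trans (sub_eq_zero.2 h.symm)))
        (by positivity) (by rw [div_lt_one hs]; nlinarith [pow_pos hpos 2])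
      rw [hgeo] at h
      linarith [hlow s θ hpos]
  have hcl : IsClosed (range γ₂) :=
    (hper₂.compact_of_continuous Real.two_pi_pos.ne' h₂.continuous).isClosed
  have hd₁ : ∀ s, HasDerivAt γ₁ (deriv γ₁ s) s := fun s =>
    (h₁.differentiable one_ne_zero s).hasDerivAt
  have hd₂ : ∀ s, HasDerivAt γ₂ (deriv γ₂ s) s := fun s =>
    (h₂.differentiable one_ne_zero s).hasDerivAt
  have hc₂ := h₂.continuous_deriv le_rfl
  have hmem : ∀ s, γ₁ s ∈ (range γ₂)ᶜ := by
    rintro s ⟨t, ht⟩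
    exact hdisj s t ht.symm
  have key := LocallyExactOn.integral_eq_zero_of_contraction
    (gaussForm_locallyExactOn hd₂ hc₂ (T := 2 * π) (by simpa using (hper₂ 0).symm) hcl)
    Real.two_pi_pos.le hQ hQS (T := π / 2) (by positivity)
    (fun θ => by simp only [hQdef, hA.closed θ]) (x₀ := γ₁ 0)
    (fun s => by rw [hQzero s 0 (by rw [hA.center]), hA.center]) hd₁
    (fun s => by rw [hQzero s _ (by rw [hA.boundary]), hA.boundary])
    (((continuousOn_gaussForm h₂.continuous hc₂).comp_continuous h₁.continuous hmem).clm_apply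
      (h₁.continuous_deriv le_rfl))
  simp only [gaussForm_apply h₂.continuous hc₂ (hmem _)] at key
  rw [gaussLinking, key, mul_zero]

theorem gaussLinking_eq_zero_of_norm_le {γ₁ γ₂ : ℝ → EuclideanSpace ℝ (Fin 3)}
    (h₁ : ContDiff ℝ 1 γ₁) (h₂ : ContDiff ℝ 1 γ₂)
    (hper₁ : Function.Periodic γ₁ (2 * π)) (hper₂ : Function.Periodic γ₂ (2 * π))
    (hdisj : ∀ s t, γ₁ s ≠ γ₂ t) (hE : mobiusEnergy γ₁ γ₂ < 2 * π ^ 2) {t₀ : ℝ}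
    (hle : ∀ s, ‖γ₁ s‖ ≤ ‖γ₂ t₀‖) :
    gaussLinking γ₁ γ₂ = 0 := by
  obtain ⟨_, ⟨s₀, rfl⟩, hs₀⟩ :=
    (hper₁.compact_of_continuous Real.two_pi_pos.ne' h₁.continuous).exists_isMaxOn
      (range_nonempty γ₁) (f := fun x => inner ℝ x (γ₂ t₀)) (by fun_prop)
  refine gaussLinking_eq_zero_of_inner_le h₁ h₂ hper₁ hper₂ hdisj hE
    (fun s => hs₀ (mem_range_self s)) ?_
  have hpos : 0 < ‖γ₁ s₀ - γ₂ t₀‖ := norm_pos_iff.2 (sub_ne_zero.2 (hdisj _ _))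
  have hsq := norm_sub_sq_real (γ₁ s₀) (γ₂ t₀)
  have := pow_le_pow_left₀ (norm_nonneg _) (hle s₀) 2
  have := pow_pos hpos 2
  show inner ℝ (γ₁ s₀) (γ₂ t₀) < _
  linarith

end Linking

/-- (Agol–Marques–Neves; conjecture of Freedman–He–Wang) Every `2`-component link in `ℝ³`
with linking number `±1` has Möbius cross energy at least `2π²`. -/
theorem mobiusEnergy_ge_two_pi_sq (γ₁ γ₂ : ℝ → EuclideanSpace ℝ (Fin 3))
    (h₁ : ContDiff ℝ 1 γ₁) (h₂ : ContDiff ℝ 1 γ₂)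
    (hper₁ : Function.Periodic γ₁ (2 * π)) (hper₂ : Function.Periodic γ₂ (2 * π))
    (hdisj : ∀ s t, γ₁ s ≠ γ₂ t)
    (hlk : |gaussLinking γ₁ γ₂| = 1) :
    mobiusEnergy γ₁ γ₂ ≥ 2 * π ^ 2 := by
  by_contra! hE
  have hmax : ∀ {γ : ℝ → EuclideanSpace ℝ (Fin 3)}, ContDiff ℝ 1 γ →
      Function.Periodic γ (2 * π) → ∃ s₀, ∀ s, ‖γ s‖ ≤ ‖γ s₀‖ := fun {γ} hγ hper => by
    obtain ⟨_, ⟨s₀, rfl⟩, hs₀⟩ :=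
      (hper.compact_of_continuous Real.two_pi_pos.ne' hγ.continuous).exists_isMaxOn
        (range_nonempty γ) continuous_norm.continuousOn
    exact ⟨s₀, fun s => hs₀ (mem_range_self s)⟩
  obtain ⟨s₀, hs₀⟩ := hmax h₁ hper₁
  obtain ⟨t₀, ht₀⟩ := hmax h₂ hper₂
  have hzero : gaussLinking γ₁ γ₂ = 0 := by
    rcases le_total ‖γ₁ s₀‖ ‖γ₂ t₀‖ with h | h
    · exact gaussLinking_eq_zero_of_norm_le h₁ h₂ hper₁ hper₂ hdisj hE
        fun s => (hs₀ s).trans h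
    · rw [gaussLinking_comm h₁ h₂ hdisj]
      rw [mobiusEnergy_comm h₁ h₂ hdisj] at hE
      exact gaussLinking_eq_zero_of_norm_le h₂ h₁ hper₂ hper₁ (fun s t => (hdisj t s).symm) hE
        fun t => (ht₀ t).trans h
  simp [hzero] at hlk

end
end
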